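/- Let $1 \leq m \leq n$, integers $i_1,\dots,i_m \geq 0$ with $|i| := i_1+\cdots+i_m \leq n$, and $A, B_1,\dots,B_m$ convex bodies in $\mathbb{R}^n$. Then for every $j \in \{1,\dots,m\}$: $\frac{n!\,(|i|-i_j)!}{i_1!\cdots i_m!\,(n-i_j)!} |A|^{m-1} V(B_1[i_1],\dots,B_m[i_m],A[n-|i|]) \leq \prod_{k=1}^m \binom{n}{i_k} V(B_k[i_k], A[n-i_k])$. -/

import Mathlib

open scoped Pointwise
open MeasureTheory

/-- A convex body in `ℝⁿ`: a compact convex set with nonempty interior. -/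
def IsConvexBody {n : ℕ} (K : Set (EuclideanSpace ℝ (Fin n))) : Prop :=
  Convex ℝ K ∧ IsCompact K ∧ (interior K).Nonempty

/-- The mixed volume of `n` convex bodies in `ℝⁿ`, via the
inclusion-exclusion (polarization) formula for Minkowski sums. -/
noncomputable def mixedVolume {n : ℕ} (K : Fin n → Set (EuclideanSpace ℝ (Fin n))) : ℝ :=
  ((n.factorial : ℝ))⁻¹ *
    ∑ S : Finset (Fin n), (-1 : ℝ) ^ (n + S.card) * (volume (∑ i ∈ S, K i)).toReal

/-- The list `B 0` repeated `i 0` times, then `B 1` repeated `i 1` times, etc. -/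
def blocks {α : Type*} {m : ℕ} (i : Fin m → ℕ) (B : Fin m → α) : List α :=
  (List.ofFn fun k => List.replicate (i k) (B k)).flatten

namespace XM

/-- The unnormalised mixed volume. -/
noncomputable def mvol {n : ℕ} {F : Type*} [AddCommMonoid F] [MeasureSpace F]
    (K : Fin n → Set F) : ℝ :=
  ∑ S : Finset (Fin n), (-1 : ℝ) ^ (n + S.card) * (volume (∑ i ∈ S, K i)).toReal

theorem mixedVolume_eq {n : ℕ} (K : Fin n → Set (EuclideanSpace ℝ (Fin n))) :
    mixedVolume K = ((n.factorial : ℝ))⁻¹ * mvol K := rfl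

theorem isCompact_sum {ι F : Type*} [AddCommMonoid F] [TopologicalSpace F] [ContinuousAdd F]
    (S : Finset ι) (K : ι → Set F) (h : ∀ i ∈ S, IsCompact (K i)) :
    IsCompact (∑ i ∈ S, K i) := by
  classical
  induction S using Finset.induction_on with
  | empty => simp
  | insert a s ha ih =>
    rw [Finset.sum_insert ha]
    exact (h a (by simp)).add (ih fun i hi => h i (by simp [hi]))

theorem convex_sum' {ι F : Type*} [AddCommGroup F] [Module ℝ F]
    (S : Finset ι) (K : ι → Set F) (h : ∀ i ∈ S, Convex ℝ (K i)) :
    Convex ℝ (∑ i ∈ S, K i) := by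
  classical
  induction S using Finset.induction_on with
  | empty => exact convex_singleton (𝕜 := ℝ) (0 : F)
  | insert a s ha ih =>
    rw [Finset.sum_insert ha]
    exact (h a (by simp)).add (ih fun i hi => h i (by simp [hi]))

theorem sum_subset {ι F : Type*} [AddCommMonoid F]
    (S : Finset ι) (K K' : ι → Set F) (h : ∀ i ∈ S, K i ⊆ K' i) :
    ∑ i ∈ S, K i ⊆ ∑ i ∈ S, K' i := by
  classical
  induction S using Finset.induction_on with
  | empty => simp
  | insert a s ha ih =>
    rw [Finset.sum_insert ha, Finset.sum_insert ha]
    exact Set.add_subset_add (h a (by simp)) (ih fun i hi => h i (by simp [hi]))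

section sub
variable {n : ℕ}

/-- Euclidean space -/
abbrev Euc (n : ℕ) := EuclideanSpace ℝ (Fin n)
/-- its dual -/
abbrev Dl (n : ℕ) := EuclideanSpace ℝ (Fin n) →L[ℝ] ℝ

open Classical in
/-- the points of `P` at which `a ↦ x a + w a` is maximal -/
noncomputable def top (P : Finset (Euc n)) (w : (Euc n) → ℝ) (x : (Dl n)) : Finset (Euc n) :=
  P.filter fun a => ∀ b ∈ P, x b + w b ≤ x a + w a

/-- the cell of the regular subdivision dual to `x` -/
noncomputable def cell (P : Finset (Euc n)) (w : (Euc n) → ℝ) (x : (Dl n)) : Set (Euc n) :=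
  convexHull ℝ (top P w x : Set (Euc n))

theorem mem_top {P : Finset (Euc n)} {w : (Euc n) → ℝ} {x : (Dl n)} {a : (Euc n)} :
    a ∈ top P w x ↔ a ∈ P ∧ ∀ b ∈ P, x b + w b ≤ x a + w a := by
  classical
  simp [top]

theorem top_nonempty {P : Finset (Euc n)} (hP : P.Nonempty) (w : (Euc n) → ℝ) (x : (Dl n)) :
    (top P w x).Nonempty := by
  obtain ⟨a, ha, h⟩ := P.exists_max_image (fun a => x a + w a) hP
  exact ⟨a, mem_top.2 ⟨ha, h⟩⟩

/-- support-type function -/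
noncomputable def fmax (P : Finset (Euc n)) (hP : P.Nonempty) (w : (Euc n) → ℝ) (x : (Dl n)) : ℝ :=
  P.sup' hP fun a => x a + w a

theorem le_fmax {P : Finset (Euc n)} (hP : P.Nonempty) (w : (Euc n) → ℝ) (x : (Dl n)) {a : (Euc n)} (ha : a ∈ P) :
    x a + w a ≤ fmax P hP w x :=
  Finset.le_sup' (fun a => x a + w a) ha

theorem fmax_eq {P : Finset (Euc n)} (hP : P.Nonempty) (w : (Euc n) → ℝ) (x : (Dl n)) {a : (Euc n)}
    (ha : a ∈ top P w x) : fmax P hP w x = x a + w a := by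
  rw [mem_top] at ha
  exact le_antisymm (Finset.sup'_le _ _ ha.2) (le_fmax hP w x ha.1)

theorem cell_halfspace {P : Finset (Euc n)} (hP : P.Nonempty) (w : (Euc n) → ℝ) (x x' : (Dl n)) :
    cell P w x ⊆ {z | x' z - fmax P hP w x' ≤ x z - fmax P hP w x} := by
  refine convexHull_min ?_ ?_
  · intro a ha
    have h1 := fmax_eq hP w x ha
    have h2 := le_fmax hP w x' (mem_top.1 ha).1
    simp only [Set.mem_ofPred_eq]
    linarith
  · have : {z | x' z - fmax P hP w x' ≤ x z - fmax P hP w x} =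
      {z | (x' - x) z ≤ fmax P hP w x' - fmax P hP w x} := by
      ext z; simp only [Set.mem_ofPred_eq, sub_apply]
      constructor <;> intro h <;> linarith
    rw [this]
    exact convex_halfSpace_le (x' - x).isLinear _

theorem isCompact_cell (P : Finset (Euc n)) (w : (Euc n) → ℝ) (x : (Dl n)) : IsCompact (cell P w x) :=
  (Finset.finite_toSet _).isCompact_convexHull ℝ

theorem convex_cell (P : Finset (Euc n)) (w : (Euc n) → ℝ) (x : (Dl n)) : Convex ℝ (cell P w x) :=
  convex_convexHull _ _

theorem cell_subset (P : Finset (Euc n)) (w : (Euc n) → ℝ) (x : (Dl n)) :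
    cell P w x ⊆ convexHull ℝ (P : Set (Euc n)) :=
  convexHull_mono fun _ ha => (mem_top.1 ha).1

theorem volume_hyperplane {x : (Dl n)} (hx : x ≠ 0) (c : ℝ) :
    volume {z : (Euc n) | x z = c} = 0 := by
  rcases Set.eq_empty_or_nonempty {z : (Euc n) | x z = c} with h | ⟨z0, hz0⟩
  · simp [h]
  let A : AffineSubspace ℝ (Euc n) := AffineSubspace.mk' z0 (LinearMap.ker x.toLinearMap)
  have hA : {z : (Euc n) | x z = c} = A := by
    ext z
    have hz0' : x z0 = c := hz0
    simp [A, AffineSubspace.mem_mk', sub_eq_zero, hz0']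
  rw [hA]
  refine Measure.addHaar_affineSubspace volume A fun h => hx ?_
  have h1 : A.direction = ⊤ := by rw [h]; simp
  rw [AffineSubspace.direction_mk'] at h1
  ext z
  have : z ∈ LinearMap.ker x.toLinearMap := by rw [h1]; trivial
  simpa using this

theorem sum_cell_halfspace (P : Fin n → Finset (Euc n)) (hP : ∀ l, (P l).Nonempty)
    (w : Fin n → (Euc n) → ℝ) (S : Finset (Fin n)) (x x' : (Dl n)) :
    ∑ l ∈ S, cell (P l) (w l) x ⊆
      {z | x' z - ∑ l ∈ S, fmax (P l) (hP l) (w l) x' ≤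
        x z - ∑ l ∈ S, fmax (P l) (hP l) (w l) x} := by
  classical
  intro z hz
  obtain ⟨g, hg, rfl⟩ := (Set.mem_finsetSum _ _ _).1 hz
  simp only [Set.mem_ofPred_eq, map_sum, ← Finset.sum_sub_distrib]
  exact Finset.sum_le_sum fun l hl => cell_halfspace (hP l) (w l) x x' (hg hl)

theorem cell_overlap (P : Fin n → Finset (Euc n)) (hP : ∀ l, (P l).Nonempty)
    (w : Fin n → (Euc n) → ℝ) (S : Finset (Fin n)) {x x' : (Dl n)} (h : x ≠ x') :
    volume ((∑ l ∈ S, cell (P l) (w l) x) ∩ ∑ l ∈ S, cell (P l) (w l) x') = 0 := by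
  refine measure_mono_null ?_ (volume_hyperplane (sub_ne_zero.2 h)
    (∑ l ∈ S, fmax (P l) (hP l) (w l) x - ∑ l ∈ S, fmax (P l) (hP l) (w l) x'))
  rintro z ⟨h1, h2⟩
  have h1' := sum_cell_halfspace P hP w S x x' h1
  have h2' := sum_cell_halfspace P hP w S x' x h2
  simp only [Set.mem_ofPred_eq, sub_apply] at *
  linarith

theorem continuous_fmax {P : Finset (Euc n)} (hP : P.Nonempty) (w : (Euc n) → ℝ) :
    Continuous (fmax P hP w) := by
  unfold fmax
  refine Continuous.finset_sup'_apply hP fun a _ => ?_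
  fun_prop

/-- directional derivative upper bound -/
theorem fmax_dir {P : Finset (Euc n)} (hP : P.Nonempty) (w : (Euc n) → ℝ) (x u : (Dl n)) (β : ℝ)
    (hβ : ∀ a ∈ top P w x, u a ≤ β) :
    ∀ᶠ t in nhdsWithin (0 : ℝ) (Set.Ioi 0),
      fmax P hP w (x + t • u) ≤ fmax P hP w x + t * β := by
  classical
  have key : ∀ a ∈ P, ∀ᶠ t in nhdsWithin (0 : ℝ) (Set.Ioi 0),
      (x + t • u) a + w a ≤ fmax P hP w x + t * β := by
    intro a ha
    by_cases hat : a ∈ top P w x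
    · filter_upwards [self_mem_nhdsWithin] with t ht
      have := fmax_eq hP w x hat
      have h2 := mul_le_mul_of_nonneg_left (hβ a hat) (le_of_lt ht)
      simp only [add_apply, smul_apply, smul_eq_mul]
      linarith
    · have hlt : x a + w a < fmax P hP w x := by
        rcases (le_fmax hP w x ha).lt_or_eq with h | h
        · exact h
        · exact absurd (mem_top.2 ⟨ha, fun b hb => h ▸ le_fmax hP w x hb⟩) hat
      have hc : Filter.Tendsto (fun t : ℝ => (x + t • u) a + w a - t * β) (nhds 0)
          (nhds ((x + (0:ℝ) • u) a + w a - 0 * β)) := by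
        apply Continuous.tendsto
        simp only [add_apply, smul_apply, smul_eq_mul]
        fun_prop
      have := hc.eventually (eventually_lt_nhds (b := fmax P hP w x) (by simpa using hlt))
      filter_upwards [nhdsWithin_le_nhds this] with t ht
      have ht' : (x + t • u) a + w a - t * β < fmax P hP w x := ht
      linarith
  have := (Filter.eventually_all_finset P).2 key
  filter_upwards [this] with t ht
  exact Finset.sup'_le _ _ ht

theorem le_of_mem_convexHull {P : Finset (Euc n)} {x : (Dl n)} {c : ℝ} (h : ∀ a ∈ P, x a ≤ c) {z : (Euc n)}
    (hz : z ∈ convexHull ℝ (P : Set (Euc n))) : x z ≤ c :=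
  (convexHull_min (fun a ha => h a ha) (convex_halfSpace_le x.isLinear c)) hz

theorem exists_le_inner_sum (P : Fin n → Finset (Euc n)) (S : Finset (Fin n)) (w : Fin n → (Euc n) → ℝ)
    (hP : ∀ l, (P l).Nonempty) :
    ∃ C, ∀ x : (Dl n), ∀ z ∈ ∑ l ∈ S, convexHull ℝ (P l : Set (Euc n)),
      x z ≤ ∑ l ∈ S, fmax (P l) (hP l) (w l) x + C := by
  classical
  refine ⟨∑ l ∈ S, ∑ a ∈ P l, |w l a|, fun x z hz => ?_⟩
  obtain ⟨g, hg, rfl⟩ := (Set.mem_finsetSum _ _ _).1 hz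
  rw [map_sum, ← Finset.sum_add_distrib]
  refine Finset.sum_le_sum fun l hl => le_of_mem_convexHull ?_ (hg hl)
  intro a ha
  have h1 := le_fmax (hP l) (w l) x ha
  have h2 : |w l a| ≤ ∑ a ∈ P l, |w l a| :=
    Finset.single_le_sum (f := fun a => |w l a|) (fun _ _ => abs_nonneg _) ha
  have h3 := neg_abs_le (w l a)
  linarith

theorem sum_le_of_mem (P : Fin n → Finset (Euc n)) (hP : ∀ l, (P l).Nonempty) (S : Finset (Fin n))
    (u : (Dl n)) : ∃ z ∈ ∑ l ∈ S, convexHull ℝ (P l : Set (Euc n)),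
      u z = ∑ l ∈ S, (P l).sup' (hP l) u := by
  classical
  choose a ha h using fun l => (P l).exists_mem_eq_sup' (hP l) u
  refine ⟨∑ l ∈ S, a l, (Set.mem_finsetSum _ _ _).2 ⟨a, fun {l} _ => subset_convexHull ℝ _ (ha l), rfl⟩, ?_⟩
  rw [map_sum]
  exact Finset.sum_congr rfl fun l _ => (h l).symm

theorem cell_cover (P : Fin n → Finset (Euc n)) (hP : ∀ l, (P l).Nonempty)
    (w : Fin n → (Euc n) → ℝ) (S : Finset (Fin n)) {z : (Euc n)}
    (hz : z ∈ interior (∑ l ∈ S, convexHull ℝ (P l : Set (Euc n)))) :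
    ∃ x : (Dl n), z ∈ ∑ l ∈ S, cell (P l) (w l) x := by
  classical
  set ψ : (Dl n) → ℝ := fun x => ∑ l ∈ S, fmax (P l) (hP l) (w l) x - x z with hψ
  have hcont : Continuous ψ := by
    refine (continuous_finsetSum _ fun l _ => continuous_fmax _ _).sub ?_
    fun_prop
  obtain ⟨C, hC⟩ := exists_le_inner_sum P S w hP
  rw [mem_interior_iff_mem_nhds, Metric.mem_nhds_iff] at hz
  obtain ⟨r, hr, hball⟩ := hz
  have hlow : ∀ x : (Dl n), (r / 2) * ‖x‖ - C ≤ ψ x := by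
    intro x
    have hle : ‖x‖ ≤ (ψ x + C) / (r / 2) := by
      refine ContinuousLinearMap.opNorm_le_of_unit_norm (𝕜 := ℝ) ?_ ?_
      · have := hC x z (hball (Metric.mem_ball_self hr))
        apply div_nonneg _ (by positivity)
        simp only [hψ]; linarith
      · intro y hy
        rw [le_div_iff₀ (by positivity), Real.norm_eq_abs]
        have h1 := hC x (z + (r/2) • y) (hball (by simp [norm_smul, hy, abs_of_pos hr]; linarith))
        have h2 := hC x (z - (r/2) • y) (hball (by
          rw [sub_eq_add_neg]; simp [norm_smul, hy, abs_of_pos hr]; linarith))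
        simp only [map_add, map_sub, map_smul, smul_eq_mul] at h1 h2
        simp only [hψ]
        rcases abs_cases (x y) with ⟨h, _⟩ | ⟨h, _⟩ <;> rw [h] <;> nlinarith
    rw [le_div_iff₀ (by positivity)] at hle
    linarith
  have htend : Filter.Tendsto ψ (Filter.cocompact (Dl n)) Filter.atTop := by
    refine Filter.tendsto_atTop_mono hlow ?_
    refine Filter.tendsto_atTop_add_const_right _ _ ?_
    exact tendsto_norm_cocompact_atTop.const_mul_atTop (by positivity)
  obtain ⟨x, hx⟩ := hcont.exists_forall_le htend
  refine ⟨x, ?_⟩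
  by_contra hzc
  obtain ⟨u, s, hu1, hu2⟩ := geometric_hahn_banach_closed_point
    (convex_sum' S (fun l => cell (P l) (w l) x) fun l _ => convex_cell _ _ _)
    (isCompact_sum S (fun l => cell (P l) (w l) x) fun l _ => isCompact_cell _ _ _).isClosed hzc
  obtain ⟨y, hy, hyu⟩ := sum_le_of_mem (fun l => top (P l) (w l) x)
    (fun l => top_nonempty (hP l) _ _) S u
  have hy' := hu1 y hy
  have hev : ∀ᶠ t in nhdsWithin (0 : ℝ) (Set.Ioi 0), ∀ l ∈ S,
      fmax (P l) (hP l) (w l) (x + t • u) ≤ fmax (P l) (hP l) (w l) x +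
        t * (top (P l) (w l) x).sup' (top_nonempty (hP l) _ _) u := by
    refine (Filter.eventually_all_finset S).2 fun l _ => fmax_dir _ _ _ _ _ ?_
    intro a ha
    exact Finset.le_sup' u ha
  obtain ⟨t, ht, ht0⟩ := (hev.and self_mem_nhdsWithin).exists
  have hsum := Finset.sum_le_sum ht
  rw [Finset.sum_add_distrib, ← Finset.mul_sum, ← hyu] at hsum
  have hxt := hx (x + t • u)
  simp only [hψ, add_apply, smul_apply, smul_eq_mul] at hxt
  have ht0' : (0:ℝ) < t := ht0
  nlinarith

theorem subdivision (P : Fin n → Finset (Euc n)) (hP : ∀ l, (P l).Nonempty)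
    (w : Fin n → (Euc n) → ℝ) (X : Finset (Dl n)) :
    ∃ X' : Finset (Dl n), X ⊆ X' ∧ ∀ S : Finset (Fin n),
      (volume (∑ l ∈ S, convexHull ℝ (P l : Set (Euc n)))).toReal =
        ∑ x ∈ X', (volume (∑ l ∈ S, cell (P l) (w l) x)).toReal := by
  classical
  set τ : (Dl n) → (Fin n → Finset (Euc n)) := fun x l => top (P l) (w l) x with hτ
  have hfin : (Set.range τ).Finite := by
    refine Set.Finite.subset (Fintype.piFinset fun l => (P l).powerset).finite_toSet ?_
    rintro _ ⟨x, rfl⟩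
    simp only [Finset.mem_coe, Fintype.mem_piFinset, Finset.mem_powerset]
    intro l a ha
    exact (mem_top.1 ha).1
  let sec : (Fin n → Finset (Euc n)) → (Dl n) := fun T => if h : ∃ x, τ x = T then h.choose else 0
  have hsec : ∀ x, τ (sec (τ x)) = τ x := by
    intro x
    have h : ∃ y, τ y = τ x := ⟨x, rfl⟩
    simp only [sec, dif_pos h]
    exact h.choose_spec
  refine ⟨X ∪ hfin.toFinset.image sec, Finset.subset_union_left, fun S => ?_⟩
  set X' := X ∪ hfin.toFinset.image sec
  have hcell : ∀ x, ∃ x' ∈ X', ∀ l, cell (P l) (w l) x = cell (P l) (w l) x' := by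
    intro x
    refine ⟨sec (τ x), Finset.mem_union_right _ (Finset.mem_image_of_mem _ (by simp)), fun l => ?_⟩
    have := congrFun (hsec x) l
    simp only [hτ] at this
    rw [cell, cell, ← this]
  have hcomp : ∀ x, IsCompact (∑ l ∈ S, cell (P l) (w l) x) := fun x =>
    isCompact_sum _ _ fun l _ => isCompact_cell _ _ _
  rw [← ENNReal.toReal_sum fun x _ => (hcomp x).measure_lt_top.ne]
  congr 1
  rw [← measure_biUnion_finset₀ (f := fun x => ∑ l ∈ S, cell (P l) (w l) x)
    (fun x _ y _ hxy => cell_overlap P hP w S hxy)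
    (fun x _ => (hcomp x).measurableSet.nullMeasurableSet)]
  apply le_antisymm
  · have hconv : Convex ℝ (∑ l ∈ S, convexHull ℝ (P l : Set (Euc n))) :=
      convex_sum' _ _ fun l _ => convex_convexHull _ _
    have hc : IsCompact (∑ l ∈ S, convexHull ℝ (P l : Set (Euc n))) :=
      isCompact_sum _ _ fun l _ => (Finset.finite_toSet _).isCompact_convexHull ℝ
    calc _ ≤ volume ((⋃ x ∈ X', ∑ l ∈ S, cell (P l) (w l) x) ∪
          frontier (∑ l ∈ S, convexHull ℝ (P l : Set (Euc n)))) := by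
            refine measure_mono fun z hz => ?_
            by_cases hi : z ∈ interior (∑ l ∈ S, convexHull ℝ (P l : Set (Euc n)))
            · left
              obtain ⟨x, hx⟩ := cell_cover P hP w S hi
              obtain ⟨x', hx', he⟩ := hcell x
              simp only [Set.mem_iUnion]
              refine ⟨x', hx', ?_⟩
              rwa [← Finset.sum_congr rfl fun l _ => he l]
            · right
              rw [hc.isClosed.frontier_eq]
              exact ⟨hz, hi⟩
      _ ≤ _ := (measure_union_le _ _).trans (by rw [hconv.addHaar_frontier volume]; simp)
  · refine measure_mono (Set.iUnion₂_subset fun x _ => sum_subset _ _ _ fun l _ => cell_subset _ _ _)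

theorem mvol_subdivision (P : Fin n → Finset (Euc n)) (hP : ∀ l, (P l).Nonempty)
    (w : Fin n → (Euc n) → ℝ) (X : Finset (Dl n)) :
    ∃ X' : Finset (Dl n), X ⊆ X' ∧
      mvol (fun l => convexHull ℝ (P l : Set (Euc n))) =
        ∑ x ∈ X', mvol (fun l => cell (P l) (w l) x) := by
  obtain ⟨X', h1, h2⟩ := subdivision P hP w X
  refine ⟨X', h1, ?_⟩
  unfold mvol
  rw [Finset.sum_comm]
  refine Finset.sum_congr rfl fun S _ => ?_
  rw [h2, Finset.mul_sum]

end sub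
end XM

namespace XM
section gen
variable {n : ℕ}

theorem exists_generic (P : Fin n → Finset (Euc n)) (hP : ∀ l, (P l).Nonempty) :
    ∃ w : Fin n → Euc n → ℝ, ∀ x : Dl n, ∀ c : Fin n → Euc n → ℝ,
      (∀ l a, c l a ≠ 0 → a ∈ top (P l) (w l) x) → (∀ l, ∑ a ∈ P l, c l a = 0) →
      ∑ l, ∑ a ∈ P l, c l a • a = 0 → c = 0 := by
  classical
  let I := (l : Fin n) × (P l)
  let Bad : Finset I → (I → ℝ) → Prop := fun T μ => μ ≠ 0 ∧ (∀ i, μ i ≠ 0 → i ∈ T) ∧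
    (∀ l, ∑ a : P l, μ ⟨l, a⟩ = 0) ∧ ∑ l, ∑ a : P l, μ ⟨l, a⟩ • (a : Euc n) = 0
  let J := {T : Finset I // ∃ μ, Bad T μ}
  choose μ hμ using fun T : J => T.2
  let φ : J → ((I → ℝ) →ₗ[ℝ] ℝ) := fun T => ∑ i, (μ T i) • LinearMap.proj i
  have hφ : ∀ T w, φ T w = ∑ i, μ T i * w i := by
    intro T w; simp [φ]
  have hne : ⋃ T : J, ((LinearMap.ker (φ T) : Submodule ℝ (I → ℝ)) : Set (I → ℝ)) ≠ Set.univ := by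
    intro h
    obtain ⟨T, hT⟩ := Subspace.exists_eq_top_of_iUnion_eq_univ h
    have h1 : μ T ∈ LinearMap.ker (φ T) := by rw [hT]; trivial
    rw [LinearMap.mem_ker, hφ] at h1
    apply (hμ T).1
    funext i
    have := (Finset.sum_eq_zero_iff_of_nonneg (fun i _ => mul_self_nonneg (μ T i))).1 h1 i (Finset.mem_univ i)
    exact mul_self_eq_zero.1 this
  obtain ⟨w0, hw0⟩ := (Set.ne_univ_iff_exists_notMem _).1 hne
  refine ⟨fun l a => if h : a ∈ P l then w0 ⟨l, a, h⟩ else 0, ?_⟩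
  intro x c hc1 hc2 hc3
  by_contra hc
  set w : Fin n → Euc n → ℝ := fun l a => if h : a ∈ P l then w0 ⟨l, a, h⟩ else 0 with hw
  let T : Finset I := Finset.univ.filter fun i => (i.2 : Euc n) ∈ top (P i.1) (w i.1) x
  have hbad : Bad T (fun i => c i.1 i.2) := by
    refine ⟨fun h => hc ?_, fun i hi => ?_, fun l => ?_, ?_⟩
    · funext l a
      by_contra hla
      have := congrFun h ⟨l, a, (mem_top.1 (hc1 l a hla)).1⟩
      exact hla this
    · simp only [T, Finset.mem_filter, Finset.mem_univ, true_and]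
      exact hc1 _ _ hi
    · rw [← hc2 l]
      exact Finset.sum_coe_sort (P l) (fun a => c l a)
    · rw [← hc3]
      exact Finset.sum_congr rfl fun l _ => Finset.sum_coe_sort (P l) (fun a => c l a • a)
  let T' : J := ⟨T, _, hbad⟩
  apply hw0
  simp only [Set.mem_iUnion]
  refine ⟨T', ?_⟩
  change φ T' w0 = 0
  rw [hφ]
  obtain ⟨-, h2, h3, h4⟩ := hμ T'
  have key : ∀ i : I, μ T' i * w0 i =
      μ T' i * fmax (P i.1) (hP i.1) (w i.1) x - x (μ T' i • (i.2 : Euc n)) := by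
    rintro ⟨l, a, ha⟩
    by_cases hz : μ T' ⟨l, a, ha⟩ = 0
    · simp [hz]
    · have hm : (⟨l, a, ha⟩ : I) ∈ T := h2 _ hz
      simp only [T, Finset.mem_filter, Finset.mem_univ, true_and] at hm
      rw [fmax_eq (hP l) (w l) x hm]
      simp only [map_smul, smul_eq_mul, hw, dif_pos ha]
      ring
  rw [Finset.sum_congr rfl fun i _ => key i, Fintype.sum_sigma]
  simp only [Finset.sum_sub_distrib]
  have e1 : ∀ l, ∑ a : P l, μ T' ⟨l, a⟩ * fmax (P l) (hP l) (w l) x = 0 := by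
    intro l; rw [← Finset.sum_mul, h3 l, zero_mul]
  have e2 : ∑ l, ∑ a : P l, x (μ T' ⟨l, a⟩ • (a : Euc n)) = 0 := by
    rw [← map_zero x, ← h4]; simp only [map_sum]
  rw [e2, Finset.sum_eq_zero fun l _ => e1 l, sub_zero]

theorem generic_struct (P : Fin n → Finset (Euc n)) (hP : ∀ l, (P l).Nonempty)
    (w : Fin n → Euc n → ℝ) (x : Dl n)
    (hw : ∀ c : Fin n → Euc n → ℝ,
      (∀ l a, c l a ≠ 0 → a ∈ top (P l) (w l) x) → (∀ l, ∑ a ∈ P l, c l a = 0) →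
      ∑ l, ∑ a ∈ P l, c l a • a = 0 → c = 0) :
    (∃ l a, cell (P l) (w l) x = {a}) ∨
    ∃ a b : Fin n → Euc n, (∀ l, cell (P l) (w l) x = segment ℝ (a l) (b l)) ∧
      LinearIndependent ℝ (fun l => b l - a l) := by
  classical
  by_cases h1 : ∃ l, (top (P l) (w l) x).card = 1
  · left
    obtain ⟨l, hl⟩ := h1
    obtain ⟨a, ha⟩ := Finset.card_eq_one.1 hl
    exact ⟨l, a, by simp [cell, ha]⟩
  right
  push Not at h1
  have h2 : ∀ l, 1 < (top (P l) (w l) x).card := by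
    intro l
    have := (top_nonempty (hP l) (w l) x).card_pos
    have := h1 l
    omega
  choose a ha b hb hab using fun l => Finset.one_lt_card.1 (h2 l)
  have hsub : ∀ l v, v ∈ top (P l) (w l) x → v ∈ P l := fun l v hv => (mem_top.1 hv).1
  have key : ∀ (g : Fin n → ℝ) (k : Fin n) (c : Euc n) (s : ℝ), c ∈ top (P k) (w k) x →
      ∑ l, g l • (b l - a l) = s • (c - a k) →
      ∀ l v, (g l * ((if v = b l then 1 else 0) - (if v = a l then 1 else 0)) +
        (if l = k then s * ((if v = a k then 1 else 0) - (if v = c then 1 else 0)) else 0) : ℝ) = 0 := by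
    intro g k c s hc hs l v
    refine congrFun (congrFun (hw (fun l v => (g l * ((if v = b l then 1 else 0) - (if v = a l then 1 else 0)) +
        (if l = k then s * ((if v = a k then 1 else 0) - (if v = c then 1 else 0)) else 0) : ℝ)) ?_ ?_ ?_) l) v
    · intro l v
      contrapose!
      intro hv
      have e1 : v ≠ b l := fun h => hv (h ▸ hb l)
      have e2 : v ≠ a l := fun h => hv (h ▸ ha l)
      by_cases hl : l = k
      · subst hl
        have e3 : v ≠ c := fun h => hv (h ▸ hc)
        simp [e1, e2, e3]
      · simp [e1, e2, hl]
    · intro l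
      by_cases hl : l = k
      · subst hl
        simp [Finset.sum_add_distrib, ← Finset.mul_sum, hsub l _ (ha l), hsub l _ (hb l), hsub l _ hc]
      · simp [← Finset.mul_sum, hl, hsub l _ (ha l), hsub l _ (hb l)]
    · have e : ∀ l, ∑ v ∈ P l, (g l * ((if v = b l then 1 else 0) - (if v = a l then 1 else 0)) +
        (if l = k then s * ((if v = a k then 1 else 0) - (if v = c then 1 else 0)) else 0) : ℝ) • v
          = g l • (b l - a l) + if l = k then s • (a k - c) else 0 := by
        intro l
        by_cases hl : l = k
        · subst hl
          simp [add_smul, mul_smul, sub_smul, Finset.sum_add_distrib, ← Finset.smul_sum,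
            hsub l _ (ha l), hsub l _ (hb l), hsub l _ hc]
        · simp [mul_smul, sub_smul, ← Finset.smul_sum, hl, hsub l _ (ha l), hsub l _ (hb l)]
      rw [Finset.sum_congr rfl fun l _ => e l, Finset.sum_add_distrib, hs]
      simp [← smul_add]
  have hli : LinearIndependent ℝ (fun l => b l - a l) := by
    rw [Fintype.linearIndependent_iff]
    intro g hg l
    have := key g l (a l) 0 (ha l) (by rw [hg]; simp) l (b l)
    simpa [(hab l).symm] using this
  refine ⟨a, b, fun l => ?_, hli⟩
  have htop : top (P l) (w l) x = {a l, b l} := by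
    ext c
    simp only [Finset.mem_insert, Finset.mem_singleton]
    constructor
    · intro hc
      by_contra hne
      push Not at hne
      have hn : 0 < n := l.pos
      have : Nonempty (Fin n) := ⟨l⟩
      let B := basisOfLinearIndependentOfCardEqFinrank hli (by simp)
      have hB := B.sum_repr (c - a l)
      simp only [B, coe_basisOfLinearIndependentOfCardEqFinrank] at hB
      have := key _ l c 1 hc (by rw [hB, one_smul]) l c
      simp [hne.1, hne.2] at this
    · rintro (rfl | rfl)
      · exact ha l
      · exact hb l
  rw [cell, htop]
  simp [convexHull_pair]

theorem mvol_eq_zero_of_singleton (K : Fin n → Set (Euc n)) (l : Fin n) (a : Euc n)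
    (h : K l = {a}) : mvol K = 0 := by
  classical
  unfold mvol
  have key : ∀ S : Finset (Fin n), l ∉ S →
      volume (∑ i ∈ insert l S, K i) = volume (∑ i ∈ S, K i) := by
    intro S hS
    rw [Finset.sum_insert hS, h, Set.singleton_add, Set.image_add_left, measure_preimage_add]
  refine Finset.sum_involution (fun S _ => if l ∈ S then S.erase l else insert l S) ?_ ?_ ?_ ?_
  · intro S _
    by_cases hS : l ∈ S
    · have h1 := key (S.erase l) (by simp)
      rw [Finset.insert_erase hS] at h1
      have h2 := Finset.card_erase_add_one hS
      simp only [hS, if_true, h1, ← h2]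
      ring
    · simp only [hS, if_false, key S hS, Finset.card_insert_of_notMem hS]
      ring
  · intro S _ _
    by_cases hS : l ∈ S
    · simp [hS]
    · simp [hS]
  · intros; simp
  · intro S _
    by_cases hS : l ∈ S
    · simp [hS]
    · simp [hS]

theorem mvol_translate (K : Fin n → Set (Euc n)) (c : Fin n → Euc n) :
    mvol (fun l => {c l} + K l) = mvol K := by
  unfold mvol
  refine Finset.sum_congr rfl fun S _ => ?_
  rw [Finset.sum_add_distrib, Set.finsetSum_singleton, Set.singleton_add, Set.image_add_left,
    measure_preimage_add]

/-- determinant of a linear map from coordinates to Euclidean space -/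
noncomputable def cdet (L : (Fin n → ℝ) →ₗ[ℝ] Euc n) : ℝ :=
  |LinearMap.det ((WithLp.linearEquiv 2 ℝ (Fin n → ℝ)).toLinearMap ∘ₗ L)|

theorem volume_image (L : (Fin n → ℝ) →ₗ[ℝ] Euc n) (M : Set (Fin n → ℝ)) (hM : IsCompact M) :
    (volume (L '' M)).toReal = cdet L * (volume M).toReal := by
  have h1 := Measure.addHaar_image_linearMap volume
    ((WithLp.linearEquiv 2 ℝ (Fin n → ℝ)).toLinearMap ∘ₗ L) M
  have hc : IsCompact (L '' M) := hM.image L.continuous_of_finiteDimensional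
  have h3 : volume (((WithLp.linearEquiv 2 ℝ (Fin n → ℝ)).toLinearMap ∘ₗ L) '' M) =
      volume (L '' M) := by
    rw [← (PiLp.volume_preserving_toLp (Fin n)).measure_preimage
      hc.measurableSet.nullMeasurableSet]
    congr 1
    ext y
    constructor
    · rintro ⟨z, hz, rfl⟩
      exact ⟨z, hz, rfl⟩
    · rintro ⟨z, hz, h⟩
      exact ⟨z, hz, by rw [LinearMap.comp_apply, h]; rfl⟩
  rw [← h3, h1, ENNReal.toReal_mul, ENNReal.toReal_ofReal (abs_nonneg _), cdet]

theorem mvol_image (L : (Fin n → ℝ) →ₗ[ℝ] Euc n) (K : Fin n → Set (Fin n → ℝ))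
    (hK : ∀ l, IsCompact (K l)) :
    mvol (fun l => L '' K l) = cdet L * mvol K := by
  unfold mvol
  rw [Finset.mul_sum]
  refine Finset.sum_congr rfl fun S _ => ?_
  rw [← Set.image_finsetSum, volume_image _ _ (isCompact_sum _ _ fun l _ => hK l)]
  ring

end gen
end XM

namespace XM
section loc
variable {n : ℕ}

/-- unit coordinate segment -/
def useg (l : Fin n) : Set (Fin n → ℝ) := (fun t : ℝ => Pi.single l t) '' Set.Icc 0 1

/-- projection killing the coordinates in `S` -/
noncomputable def pj (S : Finset (Fin n)) : (Fin n → ℝ) →ₗ[ℝ] (Fin n → ℝ) :=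
  LinearMap.pi fun l => if l ∈ S then 0 else LinearMap.proj l

theorem pj_apply (S : Finset (Fin n)) (z : Fin n → ℝ) (l : Fin n) :
    pj S z l = if l ∈ S then 0 else z l := by
  unfold pj
  split_ifs with h <;> simp [h]

/-- projection plus a cube -/
noncomputable def qset (S : Finset (Fin n)) (A : Set (Fin n → ℝ)) : Set (Fin n → ℝ) :=
  pj S '' A + ∑ l ∈ S, useg l

noncomputable def qv (S : Finset (Fin n)) (A : Set (Fin n → ℝ)) : ℝ :=
  (volume (qset S A)).toReal

theorem isCompact_useg (l : Fin n) : IsCompact (useg l) :=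
  isCompact_Icc.image (continuous_single (A := fun _ : Fin n => ℝ) l)

theorem convex_useg (l : Fin n) : Convex ℝ (useg l) :=
  (convex_Icc (0:ℝ) 1).linear_image (LinearMap.single ℝ (fun _ => ℝ) l)

theorem isCompact_qset (S : Finset (Fin n)) {A : Set (Fin n → ℝ)} (hA : IsCompact A) :
    IsCompact (qset S A) :=
  (hA.image (pj S).continuous_of_finiteDimensional).add
    (isCompact_sum _ _ fun l _ => isCompact_useg l)

theorem convex_qset (S : Finset (Fin n)) {A : Set (Fin n → ℝ)} (hA : Convex ℝ A) :
    Convex ℝ (qset S A) :=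
  (hA.linear_image (pj S)).add (convex_sum' _ _ fun l _ => convex_useg l)

theorem mem_useg {l : Fin n} {y : Fin n → ℝ} :
    y ∈ useg l ↔ ∃ t ∈ Set.Icc (0:ℝ) 1, Pi.single l t = y := Iff.rfl

theorem pj_useg {S : Finset (Fin n)} {l : Fin n} (h : l ∉ S) : pj S '' useg l = useg l := by
  rw [useg, Set.image_image]
  congr 1
  ext t k
  rw [pj_apply]
  split_ifs with hk
  · rw [Pi.single_eq_of_ne]
    rintro rfl; exact h hk
  · rfl

theorem add_seg (l : Fin n) (A : Set (Fin n → ℝ)) (hA : IsCompact A) (hc : Convex ℝ A) :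
    (volume (A + useg l)).toReal = (volume A).toReal + (volume (qset {l} A)).toReal := by
  have hB := hA.add (isCompact_useg l)
  have hQ := isCompact_qset {l} hA
  rw [← ENNReal.toReal_add hA.measure_lt_top.ne hQ.measure_lt_top.ne]
  congr 1
  rw [← lintegral_indicator_one hB.measurableSet, ← lintegral_indicator_one hA.measurableSet,
    ← lintegral_indicator_one hQ.measurableSet, ← lintegral_add_left]
  swap
  · exact measurable_one.indicator hA.measurableSet
  have m1 : Measurable ((A + useg l).indicator (1 : (Fin n → ℝ) → ENNReal)) :=
    measurable_one.indicator hB.measurableSet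
  have m2 : Measurable (A.indicator (1 : (Fin n → ℝ) → ENNReal)) :=
    measurable_one.indicator hA.measurableSet
  have m3 : Measurable ((qset {l} A).indicator (1 : (Fin n → ℝ) → ENNReal)) :=
    measurable_one.indicator hQ.measurableSet
  rw [volume_pi]
  refine lintegral_eq_of_lmarginal_eq {l} m1 (m2.add m3) ?_
  ext x
  rw [lmarginal_singleton, lmarginal_singleton]
  have hu : Continuous fun t : ℝ => Function.update x l t := continuous_const.update l continuous_id
  have hI : ∀ M : Set (Fin n → ℝ), IsCompact M → ∫⁻ t, M.indicator (1 : (Fin n → ℝ) → ENNReal)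
      (Function.update x l t) = volume {t : ℝ | Function.update x l t ∈ M} := by
    intro M hM
    have : MeasurableSet {t : ℝ | Function.update x l t ∈ M} :=
      hM.measurableSet.preimage hu.measurable
    rw [← lintegral_indicator_one this]
    rfl
  simp only []
  rw [lintegral_add_left]
  swap
  · exact m2.comp hu.measurable
  rw [hI _ hB, hI _ hA, hI _ hQ]
  set I : Set ℝ := {t : ℝ | Function.update x l t ∈ A} with hIdef
  have e1 : {t : ℝ | Function.update x l t ∈ A + useg l} = I + Set.Icc 0 1 := by
    ext t
    constructor
    · rintro ⟨a, ha, _, ⟨s, hs, rfl⟩, h⟩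
      refine ⟨t - s, ?_, s, hs, by simp⟩
      have : Function.update x l (t - s) = a := by
        ext k
        have := congrFun h k
        by_cases hk : k = l
        · subst hk; simp at this ⊢; linarith
        · simp [hk] at this ⊢; linarith
      show _ ∈ A
      rwa [this]
    · rintro ⟨a, ha, s, hs, rfl⟩
      refine ⟨_, ha, _, ⟨s, hs, rfl⟩, ?_⟩
      ext k
      by_cases hk : k = l
      · subst hk; simp
      · simp [hk]
  have e2 : {t : ℝ | Function.update x l t ∈ qset {l} A} =
      {t | I.Nonempty ∧ t ∈ Set.Icc (0:ℝ) 1} := by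
    ext t
    constructor
    · rintro ⟨_, ⟨z, hz, rfl⟩, b, hb, h⟩
      rw [Finset.sum_singleton] at hb
      obtain ⟨s, hs, rfl⟩ := hb
      have h1 : Function.update x l (z l) = z := by
        ext k
        have := congrFun h k
        by_cases hk : k = l
        · subst hk; simp
        · simp [hk, pj_apply] at this ⊢; linarith
      have h2 := congrFun h l
      simp [pj_apply] at h2
      refine ⟨⟨z l, ?_⟩, h2 ▸ hs⟩
      show _ ∈ A
      rwa [h1]
    · rintro ⟨⟨s, hs⟩, ht⟩
      refine ⟨_, ⟨_, hs, rfl⟩, _, by rw [Finset.sum_singleton]; exact ⟨t, ht, rfl⟩, ?_⟩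
      ext k
      by_cases hk : k = l
      · subst hk; simp [pj_apply]
      · simp [hk, pj_apply]
  rw [e1, e2]
  by_cases hne : I.Nonempty
  · have hIcl : IsClosed I := hA.isClosed.preimage hu
    have hIb : IsCompact I := by
      have : I ⊆ (fun z : Fin n → ℝ => z l) '' A := fun t ht => ⟨_, ht, by simp⟩
      exact (hA.image (continuous_apply l)).of_isClosed_subset hIcl this
    have hIc : Convex ℝ I := by
      intro s hs t ht a b ha hb hab
      have := hc hs ht ha hb hab
      show _ ∈ A
      convert this using 1
      ext k
      by_cases hk : k = l
      · subst hk; simp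
      · simp [hk, ← add_mul, hab]
    have hII : I = Set.Icc (sInf I) (sSup I) :=
      eq_Icc_of_connected_compact ⟨hne, hIc.isPreconnected⟩ hIb
    have hle : sInf I ≤ sSup I := by
      by_contra h
      rw [hII, Set.Icc_eq_empty h] at hne
      exact Set.not_nonempty_empty hne
    have : {t | I.Nonempty ∧ t ∈ Set.Icc (0:ℝ) 1} = Set.Icc 0 1 := by ext; simp [hne]
    rw [this]
    generalize sInf I = a at *
    generalize sSup I = b at *
    rw [hII, Set.Icc_add_Icc hle zero_le_one, Real.volume_Icc, Real.volume_Icc, Real.volume_Icc,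
      ← ENNReal.ofReal_add (by linarith) (by norm_num)]
    congr 1; ring
  · rw [Set.not_nonempty_iff_eq_empty] at hne
    simp [hne]

theorem pj_pj (S T : Finset (Fin n)) (z : Fin n → ℝ) : pj S (pj T z) = pj (S ∪ T) z := by
  ext k
  simp only [pj_apply, Finset.mem_union]
  split_ifs <;> tauto

theorem qset_qset {W : Finset (Fin n)} {l : Fin n} (hl : l ∉ W) (A : Set (Fin n → ℝ)) :
    qset W (qset {l} A) = qset (insert l W) A := by
  unfold qset
  rw [Finset.sum_singleton, Set.image_add, Set.image_image, pj_useg hl, Finset.sum_insert hl]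
  simp only [pj_pj]
  rw [Finset.union_comm, ← Finset.insert_eq, add_assoc]

theorem pj_sum_useg {S U : Finset (Fin n)} (h : Disjoint S U) :
    pj S '' (∑ l ∈ U, useg l) = ∑ l ∈ U, useg l := by
  rw [Set.image_finsetSum]
  refine Finset.sum_congr rfl fun l hl => pj_useg ?_
  exact fun h' => Finset.disjoint_left.1 h h' hl

theorem volume_add_sum (U : Finset (Fin n)) (A : Set (Fin n → ℝ)) (hA : IsCompact A)
    (hc : Convex ℝ A) :
    (volume (A + ∑ l ∈ U, useg l)).toReal = ∑ W ∈ U.powerset, qv W A := by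
  classical
  induction U using Finset.induction_on generalizing A with
  | empty =>
    have : pj (∅ : Finset (Fin n)) = LinearMap.id := by
      ext; simp [pj_apply]
    simp [qv, qset, this]
  | insert l U hl ih =>
    rw [Finset.sum_insert hl, Finset.sum_powerset_insert hl, add_comm (useg l), ← add_assoc,
      add_seg _ _ (hA.add (isCompact_sum _ _ fun l _ => isCompact_useg l))
        (hc.add (convex_sum' _ _ fun l _ => convex_useg l)), ih A hA hc]
    congr 1
    have : qset {l} (A + ∑ l ∈ U, useg l) = qset {l} A + ∑ l ∈ U, useg l := by
      unfold qset
      rw [Set.image_add, pj_sum_useg (by simpa using hl), add_right_comm]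
    rw [this, ih _ (isCompact_qset _ hA) (convex_qset _ hc)]
    refine Finset.sum_congr rfl fun W hW => ?_
    rw [qv, qset_qset (fun h => hl (Finset.mem_powerset.1 hW h)), qv]

theorem qv_smul (W : Finset (Fin n)) (A : Set (Fin n → ℝ)) (hA : IsCompact A) (r : ℝ)
    (hr : 0 ≤ r) : qv W (r • A) = r ^ (n - W.card) * qv W A := by
  classical
  let D := Matrix.toLin' (Matrix.diagonal fun l : Fin n => if l ∈ W then (1:ℝ) else r)
  have hD : ∀ z l, D z l = (if l ∈ W then (1:ℝ) else r) * z l := by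
    intro z l
    simp [D, Matrix.mulVec_diagonal]
  have h1 : qset W (r • A) = D '' qset W A := by
    unfold qset
    rw [Set.image_add, Set.image_finsetSum, ← Set.image_smul, Set.image_image, Set.image_image]
    congr 1
    · congr 1
      ext z l
      rw [pj_apply, hD, pj_apply]
      split_ifs <;> simp
    · refine Finset.sum_congr rfl fun l hl => ?_
      rw [useg, Set.image_image]
      congr 1
      ext t k
      rw [hD]
      by_cases hk : k = l
      · subst hk; simp [hl]
      · simp [hk]
  rw [qv, h1, Measure.addHaar_image_linearMap, ENNReal.toReal_mul,
    ENNReal.toReal_ofReal (abs_nonneg _), qv]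
  congr 1
  rw [LinearMap.det_toLin', Matrix.det_diagonal, Finset.prod_ite]
  simp only [Finset.prod_const, one_pow, one_mul]
  rw [abs_of_nonneg (by positivity)]
  congr 1
  rw [Finset.filter_not, Finset.card_sdiff]
  simp

theorem sum_const_set (R : Finset (Fin n)) {F : Type*} [AddCommGroup F] [Module ℝ F] (A : Set F)
    (hc : Convex ℝ A) (hne : A.Nonempty) :
    ∑ _l ∈ R, A = (R.card : ℝ) • A := by
  classical
  induction R using Finset.induction_on with
  | empty => simp [Set.zero_smul_set hne]
  | insert l R hl ih =>
    rw [Finset.sum_insert hl, ih, Finset.card_insert_of_notMem hl]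
    push_cast
    rw [hc.add_smul (by positivity) zero_le_one, one_smul, add_comm]

theorem alt_sum_pow (R : Finset (Fin n)) :
    ∑ T ∈ R.powerset, (-1 : ℝ) ^ (R.card + T.card) * (T.card : ℝ) ^ R.card = R.card.factorial := by
  have h := congrFun (fwdDiff_iter_eq_factorial (R := ℝ) (n := R.card)) 0
  rw [fwdDiff_iter_eq_sum_shift] at h
  rw [Finset.sum_powerset_apply_card
    (fun k => (-1 : ℝ) ^ (R.card + k) * (k : ℝ) ^ R.card)]
  simp only [Pi.natCast_apply] at h
  rw [← h]
  refine Finset.sum_congr rfl fun k hk => ?_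
  have hk' : k ≤ R.card := by simpa [Nat.lt_succ_iff] using hk
  have : (-1 : ℝ) ^ (R.card + k) = (-1) ^ (R.card - k) := by
    obtain ⟨c, hc⟩ := Nat.exists_eq_add_of_le hk'
    rw [hc, show k + c + k = (k + c - k) + 2 * k by omega, pow_add, pow_mul]
    simp
  rw [this]
  simp
  ring

theorem alt_sum_zero (S W : Finset (Fin n)) (l : Fin n) (hl : l ∈ S) (hW : l ∉ W) (f : Finset (Fin n) → ℝ) :
    ∑ T : Finset (Fin n), (-1 : ℝ) ^ (n + T.card) * (if W ⊆ T then f (T \ S) else 0) = 0 := by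
  classical
  have key : ∀ T : Finset (Fin n), l ∉ T →
      (if W ⊆ insert l T then f (insert l T \ S) else 0) = (if W ⊆ T then f (T \ S) else 0) := by
    intro T hT
    have h1 : W ⊆ insert l T ↔ W ⊆ T := by
      rw [Finset.subset_insert_iff, Finset.erase_eq_of_notMem hW]
    rw [Finset.insert_sdiff_of_mem _ hl]
    simp only [h1]
  refine Finset.sum_involution (fun S _ => if l ∈ S then S.erase l else insert l S) ?_ ?_ ?_ ?_
  · intro T _
    by_cases hS : l ∈ T
    · have h1 := key (T.erase l) (by simp)
      rw [Finset.insert_erase hS] at h1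
      have h2 := Finset.card_erase_add_one hS
      simp only [hS, if_true]
      rw [h1, ← h2]
      ring
    · simp only [hS, if_false]
      rw [key T hS, Finset.card_insert_of_notMem hS]
      ring
  · intro T _ _
    by_cases hS : l ∈ T
    · simp [hS]
    · simp [hS]
  · intros; simp
  · intro T _
    by_cases hS : l ∈ T
    · simp [hS]
    · simp [hS]

theorem mvol_local (S : Finset (Fin n)) (A : Set (Fin n → ℝ)) (hA : IsCompact A) (hc : Convex ℝ A)
    (hne : A.Nonempty) :
    mvol (fun l => if l ∈ S then useg l else A) = (n - S.card).factorial * qv S A := by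
  classical
  have h1 : ∀ T : Finset (Fin n), (volume (∑ l ∈ T, if l ∈ S then useg l else A)).toReal =
      ∑ W ∈ S.powerset, if W ⊆ T then ((T \ S).card : ℝ) ^ (n - W.card) * qv W A else 0 := by
    intro T
    rw [Finset.sum_ite, sum_const_set _ _ hc hne, add_comm,
      volume_add_sum _ _ (hA.smul _) (hc.smul _), ← Finset.sum_filter]
    have e1 : T.filter (· ∉ S) = T \ S := by ext; simp
    have e2 : (T.filter (· ∈ S)).powerset = S.powerset.filter (· ⊆ T) := by
      ext W; simp only [Finset.mem_powerset, Finset.mem_filter, Finset.subset_iff]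
      constructor
      · intro h; exact ⟨fun x hx => (h hx).2, fun x hx => (h hx).1⟩
      · intro h x hx; exact ⟨h.2 hx, h.1 hx⟩
    rw [e1, e2]
    exact Finset.sum_congr rfl fun W _ => qv_smul _ _ hA _ (by positivity)
  unfold mvol
  simp only [h1, Finset.mul_sum]
  rw [Finset.sum_comm, Finset.sum_eq_single S]
  · have h2 : ∀ T : Finset (Fin n), (-1 : ℝ) ^ (n + T.card) * (if S ⊆ T then ((T \ S).card : ℝ) ^ (n - S.card) * qv S A else 0) = if S ⊆ T then (-1 : ℝ) ^ (n + T.card) * (((T \ S).card : ℝ) ^ (n - S.card) * qv S A) else 0 := by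
      intro T; split_ifs <;> simp
    simp only [h2]
    rw [← Finset.sum_filter]
    have hcard : Sᶜ.card = n - S.card := by simp [Finset.card_compl]
    have := alt_sum_pow Sᶜ
    rw [hcard] at this
    rw [← this, Finset.sum_mul]
    refine Finset.sum_nbij' (fun T => T \ S) (fun R => R ∪ S) ?_ ?_ ?_ ?_ ?_
    · intro T _; simp [Finset.subset_iff]
    · intro R _; simp
    · intro T hT
      simp only [Finset.mem_filter] at hT
      exact Finset.sdiff_union_of_subset hT.2
    · intro R hR
      rw [Finset.mem_powerset] at hR
      have : Disjoint R S := by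
        rw [Finset.disjoint_left]; intro x hx; simpa using hR hx
      rw [Finset.union_sdiff_right, this.sdiff_eq_left]
    · intro T hT
      simp only [Finset.mem_filter] at hT
      have h3 := Finset.card_sdiff_add_card_eq_card hT.2
      have h4 : S.card ≤ n := by simpa using Finset.card_le_univ S
      rw [← h3, ← mul_assoc]
      congr 2
      rw [show n + ((T \ S).card + S.card) = (n - S.card + (T \ S).card) + 2 * S.card by omega,
        pow_add, pow_mul]
      simp
  · intro W hW hWS
    obtain ⟨l, hl, hlW⟩ := Finset.exists_of_ssubset
      (Finset.ssubset_iff_subset_ne.2 ⟨Finset.mem_powerset.1 hW, hWS⟩)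
    exact alt_sum_zero S W l hl hlW (fun R => (R.card : ℝ) ^ (n - W.card) * qv W A)
  · simp

end loc
end XM

namespace XM
section loc2
variable {n : ℕ}

theorem cdet_pos (L : (Fin n → ℝ) ≃ₗ[ℝ] Euc n) : 0 < cdet L.toLinearMap := by
  unfold cdet
  rw [abs_pos]
  exact (LinearEquiv.isUnit_det' (L.trans (WithLp.linearEquiv 2 ℝ (Fin n → ℝ)))).ne_zero

theorem qv_nonneg (S : Finset (Fin n)) (A : Set (Fin n → ℝ)) : 0 ≤ qv S A := ENNReal.toReal_nonneg

theorem isCompact_symm_image (L : (Fin n → ℝ) ≃ₗ[ℝ] Euc n) {A : Set (Euc n)} (hA : IsCompact A) :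
    IsCompact (L.symm '' A) :=
  hA.image L.symm.toLinearMap.continuous_of_finiteDimensional

theorem seg_struct (a b : Fin n → Euc n) (hli : LinearIndependent ℝ (fun l => b l - a l)) :
    ∃ L : (Fin n → ℝ) ≃ₗ[ℝ] Euc n, ∀ (S : Finset (Fin n)) (A : Set (Euc n)), IsCompact A →
      Convex ℝ A → A.Nonempty →
      mvol (fun l => if l ∈ S then segment ℝ (a l) (b l) else A) =
        (n - S.card).factorial * (cdet L.toLinearMap * qv S (L.symm '' A)) := by
  have : ∃ B : Module.Basis (Fin n) ℝ (Euc n), ∀ l, B l = b l - a l := by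
    rcases isEmpty_or_nonempty (Fin n) with h | h
    · have : n = 0 := by
        rcases n with _ | n
        · rfl
        · exact (h.false 0).elim
      subst this
      exact ⟨Module.Basis.empty _, fun l => l.elim0⟩
    · exact ⟨basisOfLinearIndependentOfCardEqFinrank hli (by simp), fun l => by simp⟩
  obtain ⟨B, hB⟩ := this
  refine ⟨B.equivFun.symm, fun S A hA hc hne => ?_⟩
  set L := B.equivFun.symm with hL
  have h1 : ∀ l, segment ℝ (a l) (b l) = {a l} + L '' useg l := by
    intro l
    rw [segment_eq_image', useg, Set.image_image, Set.singleton_add, Set.image_image]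
    congr 1
    ext1 t
    congr 1
    rw [hL, Module.Basis.equivFun_symm_apply, Finset.sum_eq_single l]
    · simp [hB]
    · intro k _ hk; simp [hk]
    · simp
  have h2 : (fun l => if l ∈ S then segment ℝ (a l) (b l) else A) =
      fun l => {if l ∈ S then a l else 0} + L '' (if l ∈ S then useg l else L.symm '' A) := by
    ext1 l
    split_ifs with h
    · exact h1 l
    · rw [Set.image_image]; simp
  have hA' := isCompact_symm_image L hA
  rw [h2, mvol_translate]
  have := mvol_image L.toLinearMap (fun l => if l ∈ S then useg l else L.symm '' A) (by
    intro l
    split_ifs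
    · exact isCompact_useg l
    · exact hA')
  simp only [LinearEquiv.coe_coe] at this
  rw [this, mvol_local S _ hA' (hc.linear_image L.symm.toLinearMap) (hne.image _)]
  ring

theorem volume_eq_cdet (L : (Fin n → ℝ) ≃ₗ[ℝ] Euc n) {A : Set (Euc n)} (hA : IsCompact A) :
    (volume A).toReal = cdet L.toLinearMap * (volume (L.symm '' A)).toReal := by
  rw [← volume_image _ _ (isCompact_symm_image L hA), Set.image_image]
  simp

theorem volume_qset_univ (A : Set (Fin n → ℝ)) (hne : A.Nonempty) : qv Finset.univ A = 1 := by
  have h0 : pj (Finset.univ : Finset (Fin n)) '' A = {0} := by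
    have : ∀ z, pj (Finset.univ : Finset (Fin n)) z = 0 := by
      intro z; ext k; simp [pj_apply]
    simp only [this]
    exact hne.image_const 0
  have h1 : ∑ l : Fin n, useg l = Set.Icc (0 : Fin n → ℝ) 1 := by
    ext y
    rw [Set.mem_finsetSum]
    constructor
    · rintro ⟨g, hg, rfl⟩
      have : ∀ k, (∑ l, g l) k ∈ Set.Icc (0:ℝ) 1 := by
        intro k
        rw [Finset.sum_apply, Finset.sum_eq_single k]
        · obtain ⟨t, ht, h⟩ := hg (Finset.mem_univ k)
          rw [← h]; simpa using ht
        · intro l _ hl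
          obtain ⟨t, ht, h⟩ := hg (Finset.mem_univ l)
          rw [← h]; simp [hl.symm]
        · simp
      exact ⟨fun k => (this k).1, fun k => (this k).2⟩
    · rintro ⟨h0, h1⟩
      exact ⟨fun l => Pi.single l (y l), fun {l} _ => ⟨y l, ⟨h0 l, h1 l⟩, rfl⟩, Finset.univ_sum_single y⟩
  rw [qv, qset, h0, h1, Set.singleton_add, Set.image_add_left, measure_preimage_add, Real.volume_Icc_pi]
  simp

theorem mvol_seg (a b : Fin n → Euc n) (hli : LinearIndependent ℝ (fun l => b l - a l)) :
    0 ≤ mvol (fun l => segment ℝ (a l) (b l)) := by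
  obtain ⟨L, hL⟩ := seg_struct a b hli
  have := hL Finset.univ {0} isCompact_singleton (convex_singleton 0) (Set.singleton_nonempty 0)
  simp only [Finset.mem_univ, if_true] at this
  rw [this]
  have := cdet_pos L
  have := qv_nonneg Finset.univ (L.symm '' {0})
  positivity

theorem mvol_nonneg (P : Fin n → Finset (Euc n)) (hP : ∀ l, (P l).Nonempty) :
    0 ≤ mvol (fun l => convexHull ℝ (P l : Set (Euc n))) := by
  obtain ⟨w, hw⟩ := exists_generic P hP
  obtain ⟨X, -, hX⟩ := mvol_subdivision P hP w ∅
  rw [hX]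
  refine Finset.sum_nonneg fun x _ => ?_
  rcases generic_struct P hP w x (hw x) with ⟨l, a, h⟩ | ⟨a, b, h, hli⟩
  · rw [mvol_eq_zero_of_singleton _ l a h]
  · simp only [h]
    exact mvol_seg a b hli

end loc2
end XM

namespace XM
section lw
variable {n m : ℕ}

/-- coordinate measures: Lebesgue off the block, unit interval on the block -/
noncomputable def cm (b : Fin n → Fin m) (k : Fin m) (l : Fin n) : Measure ℝ :=
  volume.restrict (if b l = k then Set.Icc (0:ℝ) 1 else Set.univ)

instance (b : Fin n → Fin m) (k : Fin m) (l : Fin n) : SigmaFinite (cm b k l) := by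
  unfold cm; infer_instance

theorem lw_aux (b : Fin n → Fin m) (hm : 2 ≤ m) (f : Fin m → (Fin n → ℝ) → ENNReal)
    (hf : ∀ k, Measurable (f k))
    (hinv : ∀ k l y t, b l = k → f k (Function.update y l t) = f k y) (s : Finset (Fin n)) :
    ∀ x, (∫⋯∫⁻_s, (fun y => ∏ k, f k y ^ (1 / ((m:ℝ) - 1))) ∂(fun _ => volume)) x ≤
      ∏ k, ((∫⋯∫⁻_s, f k ∂(cm b k)) x) ^ (1 / ((m:ℝ) - 1)) := by
  classical
  have hm1 : (0:ℝ) < (m:ℝ) - 1 := by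
    have : (2:ℝ) ≤ m := by exact_mod_cast hm
    linarith
  set p : ℝ := 1 / ((m:ℝ) - 1) with hp
  have hp0 : 0 ≤ p := by positivity
  have hprod : Measurable (fun y => ∏ k, f k y ^ p) :=
    Finset.measurable_prod _ fun k _ => (hf k).pow_const p
  induction s using Finset.induction_on with
  | empty => intro x; simp
  | insert l s hl ih =>
    intro x
    rw [lmarginal_insert _ hprod hl]
    set g : Fin m → ℝ → ENNReal := fun k t => (∫⋯∫⁻_s, f k ∂(cm b k)) (Function.update x l t) with hg
    have hgm : ∀ k, Measurable (g k) := fun k =>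
      ((hf k).lmarginal _).comp (measurable_update x)
    have hgc : ∀ t, g (b l) t = (∫⋯∫⁻_s, f (b l) ∂(cm b (b l))) x := by
      intro t
      simp only [hg]
      rw [lmarginal_update_of_notMem (hf _) hl]
      have : (f (b l) ∘ fun y => Function.update y l t) = f (b l) :=
        funext fun y => hinv _ _ _ _ rfl
      rw [this]
    calc ∫⁻ t, (∫⋯∫⁻_s, (fun y => ∏ k, f k y ^ p) ∂(fun _ => volume)) (Function.update x l t)
        ≤ ∫⁻ t, ∏ k, g k t ^ p := lintegral_mono fun t => ih _
      _ = ∫⁻ t, ((∫⋯∫⁻_s, f (b l) ∂(cm b (b l))) x) ^ p *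
            ∏ k ∈ Finset.univ.erase (b l), g k t ^ p := by
          refine lintegral_congr fun t => ?_
          rw [← Finset.mul_prod_erase _ _ (Finset.mem_univ (b l)), hgc]
      _ = ((∫⋯∫⁻_s, f (b l) ∂(cm b (b l))) x) ^ p *
            ∫⁻ t, ∏ k ∈ Finset.univ.erase (b l), g k t ^ p := by
          rw [lintegral_const_mul]
          exact Finset.measurable_prod _ fun k _ => (hgm k).pow_const p
      _ ≤ ((∫⋯∫⁻_s, f (b l) ∂(cm b (b l))) x) ^ p *
            ∏ k ∈ Finset.univ.erase (b l), (∫⁻ t, g k t) ^ p := by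
          gcongr
          refine ENNReal.lintegral_prod_norm_pow_le _ (fun k _ => (hgm k).aemeasurable) ?_
            fun _ _ => hp0
          rw [Finset.sum_const, Finset.card_erase_of_mem (Finset.mem_univ _), Finset.card_univ,
            Fintype.card_fin, nsmul_eq_mul, Nat.cast_sub (by omega), Nat.cast_one, hp]
          field_simp
      _ = ∏ k, ((∫⋯∫⁻_(insert l s), f k ∂(cm b k)) x) ^ p := by
          rw [← Finset.mul_prod_erase _ _ (Finset.mem_univ (b l))]
          congr 1
          · rw [lmarginal_insert _ (hf _) hl]
            congr 1
            have : ∀ t, (∫⋯∫⁻_s, f (b l) ∂(cm b (b l))) (Function.update x l t) =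
              (∫⋯∫⁻_s, f (b l) ∂(cm b (b l))) x := hgc
            simp only [this]
            simp [cm]
          · refine Finset.prod_congr rfl fun k hk => ?_
            rw [lmarginal_insert _ (hf _) hl]
            have : b l ≠ k := (Finset.ne_of_mem_erase hk).symm
            simp [cm, this, hg]

theorem loomis_whitney (b : Fin n → Fin m) (hm : 1 ≤ m) (A : Set (Fin n → ℝ)) (hA : IsCompact A)
    (hne : A.Nonempty) :
    (volume A).toReal ^ (m - 1) ≤ ∏ k, qv (Finset.univ.filter fun l => b l = k) A := by
  classical
  rcases Nat.lt_or_ge m 2 with h2 | h2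
  · have : m = 1 := by omega
    subst this
    have : ∀ k, (Finset.univ.filter fun l => b l = k) = Finset.univ := by
      intro k; ext l; simp [Subsingleton.elim (b l) k]
    simp [this, volume_qset_univ A hne]
  set S : Fin m → Finset (Fin n) := fun k => Finset.univ.filter fun l => b l = k with hS
  set C : Fin m → Set (Fin n → ℝ) := fun k => pj (S k) ⁻¹' (pj (S k) '' A) with hC
  have hpc : ∀ k, Continuous (pj (S k)) := fun k => (pj (S k)).continuous_of_finiteDimensional
  have hCm : ∀ k, MeasurableSet (C k) := fun k =>
    ((hA.image (hpc k)).isClosed.preimage (hpc k)).measurableSet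
  have hm1 : (0:ℝ) < (m:ℝ) - 1 := by
    have : (2:ℝ) ≤ m := by exact_mod_cast h2
    linarith
  have hp0 : 0 < 1 / ((m:ℝ) - 1) := by positivity
  have key := lw_aux b h2 (fun k => (C k).indicator 1) (fun k => measurable_one.indicator (hCm k))
    (by
      intro k l y t hl
      have : (Function.update y l t ∈ C k) ↔ y ∈ C k := by
        simp only [hC, Set.mem_preimage]
        have : pj (S k) (Function.update y l t) = pj (S k) y := by
          ext j
          simp only [pj_apply]
          split_ifs with hj
          · rfl
          · have : j ≠ l := by
              rintro rfl; exact hj (by simp [hS, hl])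
            simp [this]
        rw [this]
      simp only [Set.indicator, this, Pi.one_apply]) Finset.univ 0
  rw [lmarginal_univ] at key
  simp only [lmarginal_univ] at key
  have hq : ∀ k, ∫⁻ y, (C k).indicator 1 y ∂(Measure.pi (cm b k)) = volume (qset (S k) A) := by
    intro k
    rw [lintegral_indicator_one (hCm k)]
    have : Measure.pi (cm b k) = (volume : Measure (Fin n → ℝ)).restrict
      (Set.univ.pi fun l => if b l = k then Set.Icc (0:ℝ) 1 else Set.univ) := by
      rw [volume_pi, Measure.restrict_pi_pi]; rfl
    rw [this, Measure.restrict_apply (hCm k)]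
    congr 1
    ext y
    constructor
    · rintro ⟨⟨z, hz, h⟩, h'⟩
      refine ⟨_, ⟨z, hz, rfl⟩, ∑ l ∈ S k, Pi.single l (y l), ?_, ?_⟩
      · rw [Set.mem_finsetSum]
        refine ⟨fun l => Pi.single l (y l), fun {l} hl => ⟨y l, ?_, rfl⟩, rfl⟩
        have := h' l (Set.mem_univ l)
        simpa [show b l = k by simpa [hS] using hl] using this
      · rw [h]
        ext j
        simp only [Pi.add_apply, pj_apply, Finset.sum_apply, Pi.single_apply, Finset.sum_ite_eq]
        split_ifs <;> simp
    · rintro ⟨_, ⟨z, hz, rfl⟩, u, hu, rfl⟩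
      rw [Set.mem_finsetSum] at hu
      obtain ⟨g, hg, rfl⟩ := hu
      have hg1 : ∀ l ∈ S k, ∃ t ∈ Set.Icc (0:ℝ) 1, Pi.single l t = g l := fun l hl => hg hl
      choose! t ht htg using hg1
      have hsum : ∑ l ∈ S k, g l = ∑ l ∈ S k, Pi.single l (t l) :=
        Finset.sum_congr rfl fun l hl => (htg l hl).symm
      rw [hsum]
      have hsj : ∀ j, (∑ l ∈ S k, (Pi.single l (t l) : Fin n → ℝ)) j = if j ∈ S k then t j else 0 := by
        intro j
        simp only [Finset.sum_apply, Pi.single_apply, Finset.sum_ite_eq]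
      refine ⟨⟨z, hz, ?_⟩, ?_⟩
      · ext j
        simp only [pj_apply, Pi.add_apply, hsj]
        split_ifs <;> simp
      · intro j _
        simp only [Pi.add_apply, pj_apply, hsj]
        by_cases hj : b j = k
        · have hj' : j ∈ S k := by simp [hS, hj]
          simpa [hj, hj'] using ht j hj'
        · simp [hj]
  simp only [hq] at key
  have hle : volume A ≤ ∏ k, volume (qset (S k) A) ^ (1 / ((m:ℝ) - 1)) := by
    refine le_trans ?_ key
    rw [← lintegral_indicator_one hA.measurableSet, volume_pi]
    refine lintegral_mono fun y => ?_
    by_cases hy : y ∈ A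
    · have : ∀ k, y ∈ C k := fun k => ⟨y, hy, rfl⟩
      simp [hy, this]
    · simp [hy]
  have hfin : ∀ k, volume (qset (S k) A) ≠ ⊤ := fun k => (isCompact_qset (S k) hA).measure_lt_top.ne
  have h3 : volume A ^ (m - 1) ≤ ∏ k, volume (qset (S k) A) := by
    calc volume A ^ (m - 1) ≤ (∏ k, volume (qset (S k) A) ^ (1 / ((m:ℝ) - 1))) ^ (m - 1) := by
          gcongr
      _ = ∏ k, volume (qset (S k) A) := by
          rw [← Finset.prod_pow]
          refine Finset.prod_congr rfl fun k _ => ?_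
          rw [← ENNReal.rpow_natCast, ← ENNReal.rpow_mul, Nat.cast_sub (by omega), Nat.cast_one]
          rw [show 1 / ((m:ℝ) - 1) * (m - 1) = 1 by field_simp, ENNReal.rpow_one]
  have h4 := ENNReal.toReal_mono (ENNReal.prod_ne_top fun k _ => hfin k) h3
  rw [ENNReal.toReal_pow, ENNReal.toReal_prod] at h4
  exact h4

end lw
end XM

namespace XM
section ot
variable {n : ℕ} {ι : Type*} [Fintype ι] [Nonempty ι]

/-- upper envelope -/
noncomputable def env (x : ι → Dl n) (c : ι → ℝ) (y : Euc n) : ℝ :=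
  Finset.univ.sup' Finset.univ_nonempty fun j => x j y - c j

theorem le_env (x : ι → Dl n) (c : ι → ℝ) (y : Euc n) (j : ι) : x j y - c j ≤ env x c y :=
  Finset.le_sup' (fun j => x j y - c j) (Finset.mem_univ j)

theorem env_le {x : ι → Dl n} {c : ι → ℝ} {y : Euc n} {r : ℝ} (h : ∀ j, x j y - c j ≤ r) :
    env x c y ≤ r := Finset.sup'_le _ _ fun j _ => h j

theorem exists_env (x : ι → Dl n) (c : ι → ℝ) (y : Euc n) : ∃ j, env x c y = x j y - c j := by
  obtain ⟨j, -, h⟩ := Finset.exists_mem_eq_sup' Finset.univ_nonempty fun j => x j y - c j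
  exact ⟨j, h⟩

theorem continuous_env (x : ι → Dl n) : Continuous fun p : (ι → ℝ) × Euc n => env x p.1 p.2 := by
  unfold env
  refine Continuous.finset_sup'_apply _ fun j _ => ?_
  exact ((x j).continuous.comp continuous_snd).sub ((continuous_apply j).comp continuous_fst)

theorem continuous_env' (x : ι → Dl n) (c : ι → ℝ) : Continuous (env x c) :=
  (continuous_env x).comp (Continuous.prodMk_right c)

/-- the dual functional -/
noncomputable def phi (x : ι → Dl n) (A : Set (Euc n)) (M : ι → ℝ) (c : ι → ℝ) : ℝ :=
  (∫ y in A, env x c y) + ∑ j, M j * c j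

theorem continuous_phi (x : ι → Dl n) {A : Set (Euc n)} (hA : IsCompact A) (M : ι → ℝ) :
    Continuous (phi x A M) := by
  unfold phi
  refine Continuous.add ?_ (by fun_prop)
  exact continuous_parametric_integral_of_continuous (f := fun c y => env x c y)
    (continuous_env x) hA

theorem integrableOn_env (x : ι → Dl n) {A : Set (Euc n)} (hA : IsCompact A) (c : ι → ℝ) :
    IntegrableOn (env x c) A := (continuous_env' x c).continuousOn.integrableOn_compact hA

theorem exists_min (x : ι → Dl n) {A : Set (Euc n)} (hA : IsCompact A) (M : ι → ℝ)
    (hM : ∀ i, 0 ≤ M i) (hsum : ∑ i, M i = (volume A).toReal) :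
    ∃ c, ∀ c', phi x A M c ≤ phi x A M c' := by
  obtain ⟨R, hR⟩ : ∃ R : ℝ, ∀ j, ∀ y ∈ A, |x j y| ≤ R := by
    have : ∀ j, ∃ R : ℝ, ∀ y ∈ A, |x j y| ≤ R := by
      intro j
      obtain ⟨R, hR⟩ := hA.exists_bound_of_continuousOn (x j).continuous.continuousOn
      exact ⟨R, hR⟩
    choose R hR using this
    refine ⟨Finset.univ.sup' Finset.univ_nonempty R, fun j y hy => (hR j y hy).trans ?_⟩
    exact Finset.le_sup' R (Finset.mem_univ j)
  have hR0 : 0 ≤ max R 0 := le_max_right _ _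
  set D := 2 * max R 0 with hD
  obtain ⟨c, hc, hmin⟩ := (isCompact_Icc (a := (0 : ι → ℝ)) (b := fun _ => D)).exists_isMinOn
    ⟨0, le_rfl, fun _ => by simp [hD]⟩ (continuous_phi x hA M).continuousOn
  refine ⟨c, fun c' => ?_⟩
  obtain ⟨j0, -, hj0⟩ := Finset.exists_min_image Finset.univ c' Finset.univ_nonempty
  set d : ι → ℝ := fun j => c' j - c' j0 with hd
  set e : ι → ℝ := fun j => min (d j) D with he
  have h1 : phi x A M e ≤ phi x A M d := by
    unfold phi
    have : ∫ y in A, env x e y = ∫ y in A, env x d y := by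
      refine setIntegral_congr_fun hA.measurableSet fun y hy => ?_
      apply le_antisymm
      · refine env_le fun j => ?_
        rcases le_total (d j) D with h | h
        · simp only [he, min_eq_left h]
          exact le_env x d y j
        · simp only [he, min_eq_right h]
          have a1 := le_env x d y j0
          have a2 := (abs_le.1 (hR j y hy)).2
          have a3 := (abs_le.1 (hR j0 y hy)).1
          have a4 : d j0 = 0 := by simp [hd]
          have := le_max_left R 0
          linarith
      · refine env_le fun j => ?_
        have := le_env x e y j
        have h2 : e j ≤ d j := min_le_left _ _
        linarith
    rw [this]
    gcongr with j _
    · exact hM j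
    · exact min_le_left _ _
  have h2 : phi x A M d = phi x A M c' := by
    unfold phi
    have e1 : ∀ y, env x d y = env x c' y + c' j0 := by
      intro y
      apply le_antisymm
      · refine env_le fun j => ?_
        have := le_env x c' y j
        simp only [hd]; linarith
      · rw [← le_sub_iff_add_le]
        refine env_le fun j => ?_
        have := le_env x d y j
        simp only [hd] at this; linarith
    simp only [e1]
    rw [integral_add (integrableOn_env x hA c') (by
      exact (continuous_const.continuousOn (s := A)).integrableOn_compact hA)]
    simp only [setIntegral_const, smul_eq_mul, hd, mul_sub, Finset.sum_sub_distrib, ← Finset.sum_mul,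
      hsum, Measure.real]
    ring
  have h3 : phi x A M c ≤ phi x A M e := by
    refine hmin ⟨fun j => ?_, fun j => min_le_right _ _⟩
    refine le_min ?_ (by simp [hD])
    simp only [hd, Pi.zero_apply, sub_nonneg]
    exact hj0 j (Finset.mem_univ j)
  linarith

theorem semidiscrete_ot (x : ι → Dl n) {A : Set (Euc n)} (hA : IsCompact A) (M : ι → ℝ)
    (hM : ∀ i, 0 ≤ M i) (hsum : ∑ i, M i = (volume A).toReal) :
    ∃ c : ι → ℝ, ∀ i, M i ≤ (volume {y ∈ A | ∀ j, x j y - c j ≤ x i y - c i}).toReal := by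
  classical
  obtain ⟨c, hc⟩ := exists_min x hA M hM hsum
  refine ⟨c, fun i => ?_⟩
  set B : ℝ → Set (Euc n) := fun ε => {y ∈ A | ∀ j, x j y - c j ≤ x i y - c i + ε} with hB
  have hBm : ∀ ε, IsCompact (B ε) := by
    intro ε
    have : B ε = A ∩ ⋂ j, {y | x j y - c j ≤ x i y - c i + ε} := by
      ext y; simp [hB]
    rw [this]
    refine hA.inter_right (isClosed_iInter fun j => ?_)
    exact isClosed_le (by fun_prop) (by fun_prop)
  have hε : ∀ ε > 0, M i ≤ (volume (B ε)).toReal := by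
    intro ε hε
    have h := hc (fun j => if j = i then c i - ε else c j)
    set c' : ι → ℝ := fun j => if j = i then c i - ε else c j with hc'
    have h1 : ∑ j, M j * c' j = ∑ j, M j * c j - ε * M i := by
      have : ∀ j, M j * c' j = M j * c j - if j = i then ε * M i else 0 := by
        intro j
        simp only [hc']
        split_ifs with h
        · subst h; ring
        · ring
      simp [this, Finset.sum_sub_distrib]
    unfold phi at h
    rw [h1] at h
    have h2 : ∫ y in A, env x c' y ≤ ∫ y in A, (env x c y + (B ε).indicator (fun _ => ε) y) := by
      refine setIntegral_mono_on (integrableOn_env x hA c') ?_ hA.measurableSet fun y hy => ?_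
      · refine (integrableOn_env x hA c).add ?_
        refine Integrable.indicator ?_ (hBm ε).measurableSet
        exact (continuous_const.continuousOn (s := A)).integrableOn_compact hA
      · by_cases hyB : y ∈ B ε
        · simp only [hyB, Set.indicator_of_mem]
          refine env_le fun j => ?_
          have := le_env x c y j
          simp only [hc']
          split_ifs with hj
          · subst hj; linarith
          · linarith
        · simp only [hyB, not_false_eq_true, Set.indicator_of_notMem, add_zero]
          obtain ⟨j, hj⟩ := exists_env x c' y
          have hji : j ≠ i := by
            rintro rfl
            apply hyB
            refine ⟨hy, fun k => ?_⟩
            have := le_env x c' y k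
            rw [hj] at this
            simp only [hc', if_true] at this
            split_ifs at this with hk
            · subst hk; linarith
            · linarith
          rw [hj]
          have := le_env x c y j
          simpa [hc', hji] using this
    rw [integral_add (integrableOn_env x hA c) (by
      refine Integrable.indicator ?_ (hBm ε).measurableSet
      exact (continuous_const.continuousOn (s := A)).integrableOn_compact hA),
      setIntegral_indicator (hBm ε).measurableSet] at h2
    have h3 : A ∩ B ε = B ε := Set.inter_eq_right.2 fun y hy => hy.1
    rw [h3, setIntegral_const, smul_eq_mul, Measure.real] at h2
    have h4 : ε * M i ≤ ε * (volume (B ε)).toReal := by linarith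
    exact le_of_mul_le_mul_left h4 hε
  have hlim : Filter.Tendsto (fun k : ℕ => volume (B (1 / ((k:ℝ) + 1)))) Filter.atTop
      (nhds (volume (⋂ k : ℕ, B (1 / ((k:ℝ) + 1))))) := by
    refine tendsto_measure_iInter_atTop (fun k => (hBm _).measurableSet.nullMeasurableSet) ?_
      ⟨0, (hBm _).measure_lt_top.ne⟩
    intro k k' hk y hy
    refine ⟨hy.1, fun j => (hy.2 j).trans ?_⟩
    have := Nat.one_div_le_one_div (α := ℝ) hk
    gcongr
  have hinter : (⋂ k : ℕ, B (1 / ((k:ℝ) + 1))) = {y ∈ A | ∀ j, x j y - c j ≤ x i y - c i} := by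
    ext y
    rw [Set.mem_iInter]
    constructor
    · intro h
      refine ⟨(h 0).1, fun j => le_of_forall_pos_le_add fun ε hε => ?_⟩
      obtain ⟨k, hk⟩ := exists_nat_one_div_lt hε
      exact ((h k).2 j).trans (by linarith)
    · intro h k
      refine ⟨h.1, fun j => (h.2 j).trans ?_⟩
      have : 0 ≤ 1 / ((k:ℝ) + 1) := by positivity
      linarith
  rw [hinter] at hlim
  have hfin : volume {y ∈ A | ∀ j, x j y - c j ≤ x i y - c i} ≠ ⊤ :=
    (lt_of_le_of_lt (measure_mono fun y hy => hy.1) hA.measure_lt_top).ne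
  exact ge_of_tendsto' ((ENNReal.tendsto_toReal hfin).comp hlim) fun k => hε _ (by positivity)

end ot
end XM

namespace XM
section hull
variable {n : ℕ}

theorem hull_approx {C : Set (Euc n)} (hc : Convex ℝ C) (hC : IsCompact C)
    (hi : (interior C).Nonempty) {t : ℝ} (h0 : 0 < t) (h1 : t < 1) :
    ∃ F : Finset (Euc n), F.Nonempty ∧ (F : Set (Euc n)) ⊆ C ∧
      ∃ z, {z} + t • C ⊆ convexHull ℝ (F : Set (Euc n)) := by
  classical
  obtain ⟨z, hz⟩ := hi
  set I : Set (Euc n) := {(1 - t) • z} + t • C with hI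
  have hIc : IsCompact I := isCompact_singleton.add (hC.smul t)
  have hII : I ⊆ interior C := by
    rintro _ ⟨_, rfl, _, ⟨y, hy, rfl⟩, rfl⟩
    exact hc.combo_interior_self_mem_interior hz hy (by linarith) h0.le (by ring)
  have h2 : ∀ p ∈ I, ∃ F : Finset (Euc n), p ∈ interior (convexHull ℝ (F : Set (Euc n))) ∧
      (F : Set (Euc n)) ⊆ C := by
    intro p hp
    obtain ⟨b, hb1, hb2⟩ := exists_mem_interior_convexHull_affineBasis
      (mem_interior_iff_mem_nhds.1 (hII hp))
    refine ⟨Finset.univ.image b, by simpa using hb1, ?_⟩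
    refine Set.Subset.trans ?_ hb2
    simpa using subset_convexHull ℝ (Set.range b)
  choose! F hF1 hF2 using h2
  obtain ⟨T, hT1⟩ := hIc.elim_nhds_subcover' (fun p _ => interior (convexHull ℝ (F p : Set (Euc n))))
    (fun p hp => isOpen_interior.mem_nhds (hF1 p hp))
  have h3 : I ⊆ convexHull ℝ ((T.biUnion fun p => F p : Finset (Euc n)) : Set (Euc n)) := by
    intro y hy
    obtain ⟨p, hp, hy'⟩ := Set.mem_iUnion₂.1 (hT1 hy)
    refine convexHull_mono ?_ (interior_subset hy')
    intro v hv
    simp only [Finset.coe_biUnion, Set.mem_iUnion]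
    exact ⟨p, hp, hv⟩
  refine ⟨T.biUnion fun p => F p, ?_, ?_, _, h3⟩
  · have hIne : I.Nonempty := ⟨_, _, rfl, _, ⟨z, interior_subset hz, rfl⟩, rfl⟩
    have := hIne.mono h3
    rw [convexHull_nonempty_iff] at this
    exact_mod_cast this
  · intro v hv
    simp only [Finset.coe_biUnion, Set.mem_iUnion] at hv
    obtain ⟨p, hp, hv⟩ := hv
    exact hF2 p p.2 hv

theorem volume_shift_smul (z : Euc n) {t : ℝ} (h0 : 0 < t) (C : Set (Euc n)) :
    (volume ({z} + t • C)).toReal = t ^ n * (volume C).toReal := by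
  rw [Set.singleton_add, Set.image_add_left, measure_preimage_add, Measure.addHaar_smul,
    ENNReal.toReal_mul, ENNReal.toReal_ofReal (abs_nonneg _), abs_of_pos (by positivity)]
  simp

theorem interior_of_volume_pos {C : Set (Euc n)} (hc : Convex ℝ C) (h : 0 < (volume C).toReal) :
    (interior C).Nonempty := by
  by_contra hne
  rw [Set.not_nonempty_iff_eq_empty] at hne
  have h1 := hc.addHaar_frontier volume
  have h2 : volume C ≤ volume (frontier C) := measure_mono (by
    rw [frontier, hne, Set.sdiff_empty]; exact subset_closure)
  rw [h1] at h2
  have h3 : volume C = 0 := le_antisymm h2 (by simp)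
  simp [h3] at h

theorem volume_pos_of_interior {C : Set (Euc n)} (hC : IsCompact C) (h : (interior C).Nonempty) :
    0 < (volume C).toReal :=
  ENNReal.toReal_pos (Measure.measure_pos_of_nonempty_interior _ h).ne' hC.measure_lt_top.ne

theorem volume_hull_approx {C D : Set (Euc n)} (hD : IsCompact D) {z : Euc n} {t : ℝ} (h0 : 0 < t)
    (h : {z} + t • C ⊆ D) : t ^ n * (volume C).toReal ≤ (volume D).toReal := by
  rw [← volume_shift_smul z h0]
  exact ENNReal.toReal_mono hD.measure_lt_top.ne (measure_mono h)

theorem tendsto_mvol (K : Fin n → Set (Euc n)) (hK : ∀ l, IsCompact (K l))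
    (Kt : ℝ → Fin n → Set (Euc n))
    (hsub : ∀ t, 0 < t → t < 1 → ∀ l, IsCompact (Kt t l) ∧ Kt t l ⊆ K l ∧ ∃ z, {z} + t • K l ⊆ Kt t l) :
    Filter.Tendsto (fun t => mvol (Kt t)) (nhdsWithin 1 (Set.Iio 1)) (nhds (mvol K)) := by
  classical
  unfold mvol
  refine tendsto_finsetSum _ fun S _ => Filter.Tendsto.const_mul _ ?_
  have hev : ∀ᶠ t : ℝ in nhdsWithin 1 (Set.Iio 1), 0 < t ∧ t < 1 := by
    filter_upwards [Ioo_mem_nhdsLT (show (0:ℝ) < 1 by norm_num)] with t ht using ht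
  have hlow : Filter.Tendsto (fun t : ℝ => t ^ n * (volume (∑ l ∈ S, K l)).toReal)
      (nhdsWithin 1 (Set.Iio 1)) (nhds ((volume (∑ l ∈ S, K l)).toReal)) := by
    have : Continuous fun t : ℝ => t ^ n * (volume (∑ l ∈ S, K l)).toReal := by fun_prop
    have h := this.tendsto 1
    simp only [one_pow, one_mul] at h
    exact h.mono_left nhdsWithin_le_nhds
  refine tendsto_of_tendsto_of_tendsto_of_le_of_le' hlow tendsto_const_nhds ?_ ?_
  · filter_upwards [hev] with t ht
    have h := hsub t ht.1 ht.2
    choose h1 h2 z hz using h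
    refine volume_hull_approx (isCompact_sum _ _ fun l _ => h1 l) (z := ∑ l ∈ S, z l) ht.1 ?_
    have e : {∑ l ∈ S, z l} + t • ∑ l ∈ S, K l = ∑ l ∈ S, ({z l} + t • K l) := by
      rw [Finset.sum_add_distrib, Set.finsetSum_singleton, Finset.smul_sum]
    rw [e]
    exact sum_subset _ _ _ fun l _ => hz l
  · filter_upwards [hev] with t ht
    exact ENNReal.toReal_mono (isCompact_sum _ _ fun l _ => hK l).measure_lt_top.ne
      (measure_mono (sum_subset _ _ _ fun l _ => (hsub t ht.1 ht.2 l).2.1))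

theorem holder_fin {m : ℕ} (hm : 1 ≤ m) {ι : Type*} [Fintype ι] [Nonempty ι] (u : Fin m → ι → ℝ)
    (hu : ∀ k i, 0 ≤ u k i) (D : ι → ℝ) (hD : ∀ i, 0 < D i) (κ : ℝ) (hκ : 0 < κ)
    (h : ∀ i, D i ^ m * κ ≤ ∏ k, u k i) : (∑ i, D i) ^ m * κ ≤ ∏ k, ∑ i, u k i := by
  have hm0 : (0:ℝ) < m := by exact_mod_cast hm
  have hup : ∀ k i, 0 < u k i := by
    intro k i
    refine lt_of_le_of_ne (hu k i) fun h0 => ?_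
    have h1 := h i
    rw [Finset.prod_eq_zero (Finset.mem_univ k) h0.symm] at h1
    have := hD i
    have : 0 < D i ^ m * κ := by positivity
    linarith
  set U : Fin m → ℝ := fun k => ∑ i, u k i with hU
  have hUp : ∀ k, 0 < U k := fun k => Finset.sum_pos (fun i _ => hup k i) Finset.univ_nonempty
  set G := ∏ k, U k with hG
  have hGp : 0 < G := Finset.prod_pos fun k _ => hUp k
  have h1 : ∀ i, D i * (κ / G) ^ (1 / (m:ℝ)) ≤ ∑ k, (1 / (m:ℝ)) * (u k i / U k) := by
    intro i
    calc D i * (κ / G) ^ (1 / (m:ℝ)) = (D i ^ m * (κ / G)) ^ (1 / (m:ℝ)) := by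
          rw [Real.mul_rpow (pow_nonneg (hD i).le _) (by positivity), ← Real.rpow_natCast,
            ← Real.rpow_mul (hD i).le, mul_one_div_cancel hm0.ne', Real.rpow_one]
      _ ≤ (∏ k, (u k i / U k)) ^ (1 / (m:ℝ)) := by
          refine Real.rpow_le_rpow (mul_nonneg (pow_nonneg (hD i).le _) (by positivity)) ?_ (by positivity)
          rw [Finset.prod_div_distrib, ← mul_div_assoc]
          exact div_le_div_of_nonneg_right (h i) hGp.le
      _ = ∏ k, (u k i / U k) ^ (1 / (m:ℝ)) :=
          (Real.finsetProd_rpow _ _ (fun k _ => div_nonneg (hu k i) (hUp k).le) _).symm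
      _ ≤ _ := Real.geom_mean_le_arith_mean_weighted _ _ _ (fun _ _ => by positivity)
          (by simp [hm0.ne']) (fun k _ => div_nonneg (hu k i) (hUp k).le)
  have h2 : (∑ i, D i) * (κ / G) ^ (1 / (m:ℝ)) ≤ 1 := by
    rw [Finset.sum_mul]
    refine (Finset.sum_le_sum fun i _ => h1 i).trans ?_
    rw [Finset.sum_comm]
    have : ∀ k, ∑ i, (1 / (m:ℝ)) * (u k i / U k) = 1 / m := by
      intro k
      rw [← Finset.mul_sum, ← Finset.sum_div, div_self (hUp k).ne', mul_one]
    simp only [this]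
    simp [hm0.ne']
  have h3 : ((∑ i, D i) * (κ / G) ^ (1 / (m:ℝ))) ^ m ≤ 1 :=
    pow_le_one₀ (mul_nonneg (Finset.sum_nonneg fun i _ => (hD i).le) (by positivity)) h2
  rw [mul_pow, ← Real.rpow_natCast ((κ / G) ^ (1 / (m:ℝ))), ← Real.rpow_mul (by positivity),
    one_div_mul_cancel hm0.ne', Real.rpow_one, ← mul_div_assoc, div_le_one hGp] at h3
  exact h3

end hull
end XM

namespace XM
section gp
variable {n m : ℕ}

theorem seg_data (P : Fin n → Finset (Euc n)) (hP : ∀ l, (P l).Nonempty) (w : Fin n → Euc n → ℝ)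
    (x : Dl n)
    (hs : (∃ l a, cell (P l) (w l) x = {a}) ∨ ∃ a b : Fin n → Euc n,
      (∀ l, cell (P l) (w l) x = segment ℝ (a l) (b l)) ∧ LinearIndependent ℝ (fun l => b l - a l))
    (hne : mvol (fun l => cell (P l) (w l) x) ≠ 0) :
    ∃ L : (Fin n → ℝ) ≃ₗ[ℝ] Euc n, mvol (fun l => cell (P l) (w l) x) = cdet L.toLinearMap ∧
      ∀ (S : Finset (Fin n)) (A : Set (Euc n)), IsCompact A → Convex ℝ A → A.Nonempty →
      mvol (fun l => if l ∈ S then cell (P l) (w l) x else A) =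
        (n - S.card).factorial * (cdet L.toLinearMap * qv S (L.symm '' A)) := by
  rcases hs with ⟨l, a, h⟩ | ⟨a, b, h, hli⟩
  · exact absurd (mvol_eq_zero_of_singleton _ l a h) hne
  · obtain ⟨L, hL⟩ := seg_struct a b hli
    refine ⟨L, ?_, ?_⟩
    · have := hL Finset.univ {0} isCompact_singleton (convex_singleton 0) (Set.singleton_nonempty 0)
      simp only [Finset.mem_univ, if_true] at this
      simp only [h]
      rw [this, volume_qset_univ _ ((Set.singleton_nonempty _).image _)]
      simp
    · intro S A h1 h2 h3
      simp only [h]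
      exact hL S A h1 h2 h3

theorem G_poly_t (hm : 1 ≤ m) (P : Fin n → Finset (Euc n)) (hP : ∀ l, (P l).Nonempty)
    (PA : Finset (Euc n)) (hPA : PA.Nonempty)
    (hvol : 0 < (volume (convexHull ℝ (PA : Set (Euc n)))).toReal) (b : Fin n → Fin m)
    (t : ℝ) (h0 : 0 < t) (h1 : t < 1) :
    (t ^ n * (volume (convexHull ℝ (PA : Set (Euc n)))).toReal) ^ (m - 1) *
      mvol (fun l => convexHull ℝ (P l : Set (Euc n))) ≤
    ∏ k, mvol (fun l => if b l = k then convexHull ℝ (P l : Set (Euc n))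
        else convexHull ℝ (PA : Set (Euc n))) /
          (n - (Finset.univ.filter fun l => b l = k).card).factorial := by
  classical
  obtain ⟨w, hw⟩ := exists_generic P hP
  obtain ⟨X0, -, hX0⟩ := mvol_subdivision P hP w ∅
  set X := X0.filter fun x => mvol (fun l => cell (P l) (w l) x) ≠ 0 with hX
  have hN : mvol (fun l => convexHull ℝ (P l : Set (Euc n))) =
      ∑ x ∈ X, mvol (fun l => cell (P l) (w l) x) := by
    rw [hX0, hX, Finset.sum_filter_ne_zero]
  set A := convexHull ℝ (PA : Set (Euc n)) with hA
  have hAc : Convex ℝ A := convex_convexHull _ _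
  have hAk : IsCompact A := PA.finite_toSet.isCompact_convexHull (𝕜 := ℝ)
  rcases X.eq_empty_or_nonempty with hXe | hXne
  · rw [hN, hXe, Finset.sum_empty, mul_zero]
    refine Finset.prod_nonneg fun k _ => div_nonneg ?_ (by positivity)
    have := mvol_nonneg (fun l => if b l = k then P l else PA)
      (fun l => by split_ifs; exacts [hP l, hPA])
    have e : (fun l => convexHull ℝ ((if b l = k then P l else PA : Finset (Euc n)) : Set (Euc n)))
        = fun l => if b l = k then convexHull ℝ (P l : Set (Euc n)) else A := by
      ext1 l
      split_ifs <;> rfl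
    rwa [e] at this
  have hι : Nonempty X := hXne.to_subtype
  have hLex : ∀ x : X, _ := fun x => seg_data P hP w x (generic_struct P hP w x (hw x))
    (Finset.mem_filter.1 x.2).2
  choose L hL1 hL2 using hLex
  set D : X → ℝ := fun x => cdet (L x).toLinearMap with hD
  have hDp : ∀ x, 0 < D x := fun x => cdet_pos _
  have hN2 : mvol (fun l => convexHull ℝ (P l : Set (Euc n))) = ∑ x, D x := by
    rw [hN, ← Finset.sum_coe_sort]
    exact Finset.sum_congr rfl fun x _ => hL1 x
  rw [hN2]
  set N := ∑ x, D x with hNdef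
  have hNp : 0 < N := Finset.sum_pos (fun x _ => hDp x) Finset.univ_nonempty
  set vA := (volume A).toReal with hvA
  obtain ⟨c, hc⟩ := semidiscrete_ot (fun x : X => (x : Dl n)) hAk (fun x => vA * D x / N)
    (fun x => by have := hDp x; positivity)
    (by rw [← Finset.sum_div, ← Finset.mul_sum, ← hNdef, mul_div_assoc, div_self hNp.ne', mul_one])
  set C : X → Set (Euc n) := fun i => {y ∈ A | ∀ j : X, (j : Dl n) y - c j ≤ (i : Dl n) y - c i} with hC
  have hCe : ∀ i, C i = A ∩ ⋂ j : X, {y | (j : Dl n) y - c j ≤ (i : Dl n) y - c i} := by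
    intro i; ext y; simp [hC]
  have hCk : ∀ i, IsCompact (C i) := by
    intro i
    rw [hCe]
    refine hAk.inter_right (isClosed_iInter fun j => ?_)
    exact isClosed_le (by fun_prop) (by fun_prop)
  have hCc : ∀ i, Convex ℝ (C i) := by
    intro i
    rw [hCe]
    refine hAc.inter (convex_iInter fun j => ?_)
    have : {y | (j : Dl n) y - c j ≤ (i : Dl n) y - c i} =
        {y | ((j : Dl n) - (i : Dl n)) y ≤ c j - c i} := by
      ext y
      simp only [Set.mem_ofPred_eq, sub_apply]
      constructor <;> intro h <;> linarith
    rw [this]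
    exact convex_halfSpace_le ((j : Dl n) - (i : Dl n)).toLinearMap.isLinear _
  have hCp : ∀ i, 0 < (volume (C i)).toReal := fun i =>
    lt_of_lt_of_le (by have := hDp i; positivity) (hc i)
  have hF := fun i => hull_approx (hCc i) (hCk i) (interior_of_volume_pos (hCc i) (hCp i)) h0 h1
  choose F hF1 hF2 z hF3 using hF
  set PA' := PA ∪ Finset.univ.biUnion F with hPA'
  have hPA'ne : PA'.Nonempty := hPA.mono Finset.subset_union_left
  have hPA'A : ∀ v ∈ PA', v ∈ A := by
    intro v hv
    rcases Finset.mem_union.1 hv with hv | hv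
    · exact subset_convexHull ℝ _ hv
    · obtain ⟨i, -, hi⟩ := Finset.mem_biUnion.1 hv
      exact (hF2 i hi).1
  have hconv : convexHull ℝ (PA' : Set (Euc n)) = A := by
    apply le_antisymm
    · exact convexHull_min hPA'A hAc
    · exact convexHull_mono (by exact_mod_cast Finset.subset_union_left)
  set wA : Euc n → ℝ := fun v => - env (fun x : X => (x : Dl n)) c v with hwA
  have htop : ∀ i : X, F i ⊆ top PA' wA i := by
    intro i v hv
    rw [mem_top]
    refine ⟨Finset.mem_union_right _ (Finset.mem_biUnion.2 ⟨i, Finset.mem_univ _, hv⟩), fun v' _ => ?_⟩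
    have e1 : env (fun x : X => (x : Dl n)) c v ≤ (i : Dl n) v - c i := env_le (hF2 i hv).2
    have e2 := le_env (fun x : X => (x : Dl n)) c v' i
    simp only [hwA]
    linarith
  set E : X → Set (Euc n) := fun i => cell PA' wA i with hE
  have hEk : ∀ i, IsCompact (E i) := fun i => isCompact_cell _ _ _
  have hEc : ∀ i, Convex ℝ (E i) := fun i => convex_cell _ _ _
  have hEne : ∀ i, (E i).Nonempty := fun i => by
    have := top_nonempty hPA'ne wA i
    rw [hE]
    unfold cell
    rw [convexHull_nonempty_iff]
    exact_mod_cast this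
  have hEv : ∀ i, t ^ n * (vA * D i / N) ≤ (volume (E i)).toReal := by
    intro i
    calc t ^ n * (vA * D i / N) ≤ t ^ n * (volume (C i)).toReal := by
          gcongr; exact hc i
      _ ≤ (volume (E i)).toReal := by
          refine volume_hull_approx (hEk i) h0 ((hF3 i).trans ?_)
          exact convexHull_mono (by exact_mod_cast htop i)
  set S : Fin m → Finset (Fin n) := fun k => Finset.univ.filter fun l => b l = k with hS
  set u : Fin m → X → ℝ := fun k i => D i * qv (S k) ((L i).symm '' E i) with hu
  have hu0 : ∀ k i, 0 ≤ u k i := fun k i => mul_nonneg (hDp i).le (qv_nonneg _ _)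
  have hmv : ∀ k, ∑ i, u k i ≤ mvol (fun l => if b l = k then convexHull ℝ (P l : Set (Euc n))
        else A) / (n - (S k).card).factorial := by
    intro k
    rw [le_div_iff₀ (by positivity)]
    have hPk : ∀ l, ((if b l = k then P l else PA') : Finset (Euc n)).Nonempty := by
      intro l; split_ifs; exacts [hP l, hPA'ne]
    obtain ⟨X', hXX', hX'⟩ := mvol_subdivision (fun l => if b l = k then P l else PA') hPk
      (fun l => if b l = k then w l else wA) X
    have e1 : (fun l => convexHull ℝ ((if b l = k then P l else PA' : Finset (Euc n)) : Set (Euc n)))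
        = fun l => if b l = k then convexHull ℝ (P l : Set (Euc n)) else A := by
      ext1 l
      split_ifs
      · rfl
      · exact hconv
    rw [e1] at hX'
    rw [hX', Finset.sum_mul]
    calc ∑ i, u k i * ((n - (S k).card).factorial : ℝ)
        = ∑ x ∈ X, mvol (fun l => cell (if b l = k then P l else PA') (if b l = k then w l else wA) x) := by
          rw [← Finset.sum_coe_sort X]
          refine Finset.sum_congr rfl fun i _ => ?_
          have e2 : (fun l => cell (if b l = k then P l else PA') (if b l = k then w l else wA) i) =
              fun l => if l ∈ S k then cell (P l) (w l) i else E i := by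
            ext1 l
            by_cases hl : b l = k
            · simp [hl, hS]
            · simp [hl, hS, hE]
          rw [e2, hL2 i (S k) (E i) (hEk i) (hEc i) (hEne i)]
          simp only [hu, hD]
          ring
      _ ≤ _ := by
          refine Finset.sum_le_sum_of_subset_of_nonneg hXX' fun x _ _ => ?_
          exact mvol_nonneg (fun l => top (if b l = k then P l else PA') (if b l = k then w l else wA) x)
            (fun l => top_nonempty (hPk l) _ _)
  have hkey : ∀ i, D i ^ m * (t ^ n * vA / N) ^ (m - 1) ≤ ∏ k, u k i := by
    intro i
    have hlw := loomis_whitney b hm ((L i).symm '' E i) (isCompact_symm_image _ (hEk i)) ((hEne i).image _)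
    have hv := volume_eq_cdet (L i) (hEk i)
    have hv2 := hEv i
    rw [hv] at hv2
    set q := (volume ((L i).symm '' E i)).toReal with hq
    have hq0 : t ^ n * vA / N ≤ q := by
      have : D i * (t ^ n * vA / N) ≤ D i * q := by
        calc D i * (t ^ n * vA / N) = t ^ n * (vA * D i / N) := by ring
          _ ≤ _ := hv2
      exact le_of_mul_le_mul_left this (hDp i)
    calc D i ^ m * (t ^ n * vA / N) ^ (m - 1) ≤ D i ^ m * q ^ (m - 1) := by
          have := (hDp i).le
          gcongr
      _ ≤ D i ^ m * ∏ k, qv (S k) ((L i).symm '' E i) :=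
          mul_le_mul_of_nonneg_left hlw (pow_nonneg (hDp i).le _)
      _ = ∏ k, u k i := by
          simp only [hu]
          rw [Finset.prod_mul_distrib, Finset.prod_const, Finset.card_univ, Fintype.card_fin]
  have hfin := holder_fin hm u hu0 D hDp _ (by positivity) hkey
  have hpow : N ^ m * (t ^ n * vA / N) ^ (m - 1) = (t ^ n * vA) ^ (m - 1) * N := by
    obtain ⟨r, rfl⟩ : ∃ r, m = r + 1 := ⟨m - 1, by omega⟩
    simp only [Nat.add_sub_cancel]
    rw [div_pow, pow_succ]
    field_simp
  rw [← hNdef, hpow] at hfin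
  refine hfin.trans (Finset.prod_le_prod (fun k _ => Finset.sum_nonneg fun i _ => hu0 k i) fun k _ => hmv k)

theorem G_poly (hm : 1 ≤ m) (P : Fin n → Finset (Euc n)) (hP : ∀ l, (P l).Nonempty)
    (PA : Finset (Euc n)) (hPA : PA.Nonempty)
    (hvol : 0 < (volume (convexHull ℝ (PA : Set (Euc n)))).toReal) (b : Fin n → Fin m) :
    (volume (convexHull ℝ (PA : Set (Euc n)))).toReal ^ (m - 1) *
      mvol (fun l => convexHull ℝ (P l : Set (Euc n))) ≤
    ∏ k, mvol (fun l => if b l = k then convexHull ℝ (P l : Set (Euc n))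
        else convexHull ℝ (PA : Set (Euc n))) /
          (n - (Finset.univ.filter fun l => b l = k).card).factorial := by
  have hcont : Continuous fun t : ℝ => (t ^ n * (volume (convexHull ℝ (PA : Set (Euc n)))).toReal) ^ (m - 1) *
      mvol (fun l => convexHull ℝ (P l : Set (Euc n))) := by fun_prop
  have h := (hcont.tendsto 1).mono_left (nhdsWithin_le_nhds (s := Set.Iio 1))
  simp only [one_pow, one_mul] at h
  refine le_of_tendsto h ?_
  filter_upwards [Ioo_mem_nhdsLT (show (0:ℝ) < 1 by norm_num)] with t ht
  exact G_poly_t hm P hP PA hPA hvol b t ht.1 ht.2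

theorem G_body (hm : 1 ≤ m) (K : Fin n → Set (Euc n)) (hK : ∀ l, IsConvexBody (K l))
    (A : Set (Euc n)) (hA : IsConvexBody A) (b : Fin n → Fin m) :
    (volume A).toReal ^ (m - 1) * mvol K ≤
    ∏ k, mvol (fun l => if b l = k then K l else A) /
          (n - (Finset.univ.filter fun l => b l = k).card).factorial := by
  have hap : ∀ (C : Set (Euc n)) (t : ℝ), ∃ F : Finset (Euc n), IsConvexBody C → 0 < t → t < 1 →
      F.Nonempty ∧ (F : Set (Euc n)) ⊆ C ∧ ∃ z, {z} + t • C ⊆ convexHull ℝ (F : Set (Euc n)) := by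
    intro C t
    by_cases h : IsConvexBody C ∧ 0 < t ∧ t < 1
    · obtain ⟨F, hF⟩ := hull_approx h.1.1 h.1.2.1 h.1.2.2 h.2.1 h.2.2
      exact ⟨F, fun _ _ _ => hF⟩
    · exact ⟨∅, fun h1 h2 h3 => absurd ⟨h1, h2, h3⟩ h⟩
  choose F hF using hap
  have hcomp : ∀ C : Set (Euc n), IsConvexBody C → ∀ t, 0 < t → t < 1 →
      IsCompact (convexHull ℝ (F C t : Set (Euc n))) ∧ convexHull ℝ (F C t : Set (Euc n)) ⊆ C ∧
      ∃ z, {z} + t • C ⊆ convexHull ℝ (F C t : Set (Euc n)) := by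
    intro C hC t h0 h1
    obtain ⟨-, h3, h4⟩ := hF C t hC h0 h1
    exact ⟨(F C t).finite_toSet.isCompact_convexHull (𝕜 := ℝ), convexHull_min h3 hC.1, h4⟩
  have hev : ∀ᶠ t : ℝ in nhdsWithin 1 (Set.Iio 1), 0 < t ∧ t < 1 := by
    filter_upwards [Ioo_mem_nhdsLT (show (0:ℝ) < 1 by norm_num)] with t ht using ht
  have hVA : Filter.Tendsto (fun t => (volume (convexHull ℝ (F A t : Set (Euc n)))).toReal)
      (nhdsWithin 1 (Set.Iio 1)) (nhds ((volume A).toReal)) := by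
    have hlow : Filter.Tendsto (fun t : ℝ => t ^ n * (volume A).toReal)
        (nhdsWithin 1 (Set.Iio 1)) (nhds ((volume A).toReal)) := by
      have : Continuous fun t : ℝ => t ^ n * (volume A).toReal := by fun_prop
      have h := this.tendsto 1
      simp only [one_pow, one_mul] at h
      exact h.mono_left nhdsWithin_le_nhds
    refine tendsto_of_tendsto_of_tendsto_of_le_of_le' hlow tendsto_const_nhds ?_ ?_
    · filter_upwards [hev] with t ht
      obtain ⟨h1, h2, z, hz⟩ := hcomp A hA t ht.1 ht.2
      exact volume_hull_approx h1 ht.1 hz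
    · filter_upwards [hev] with t ht
      exact ENNReal.toReal_mono hA.2.1.measure_lt_top.ne (measure_mono (hcomp A hA t ht.1 ht.2).2.1)
  have hL := (hVA.pow (m - 1)).mul (tendsto_mvol K (fun l => (hK l).2.1)
    (fun t l => convexHull ℝ (F (K l) t : Set (Euc n))) fun t h0 h1 l => hcomp _ (hK l) t h0 h1)
  have hR := tendsto_finsetProd Finset.univ fun (k : Fin m) _ =>
    (tendsto_mvol (fun l => if b l = k then K l else A)
      (fun l => by split_ifs; exacts [(hK l).2.1, hA.2.1])
    (fun t l => if b l = k then convexHull ℝ (F (K l) t : Set (Euc n)) else convexHull ℝ (F A t : Set (Euc n)))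
    fun t h0 h1 l => by
      split_ifs
      · exact hcomp _ (hK l) t h0 h1
      · exact hcomp _ hA t h0 h1).div_const
        ((n - (Finset.univ.filter fun l => b l = k).card).factorial : ℝ)
  refine le_of_tendsto_of_tendsto hL hR ?_
  filter_upwards [hev] with t ht
  refine G_poly hm (fun l => F (K l) t) (fun l => (hF _ t (hK l) ht.1 ht.2).1) (F A t)
    (hF _ t hA ht.1 ht.2).1 ?_ b
  obtain ⟨h1, h2, z, hz⟩ := hcomp A hA t ht.1 ht.2
  refine lt_of_lt_of_le ?_ (volume_hull_approx h1 ht.1 hz)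
  have := volume_pos_of_interior hA.2.1 hA.2.2
  have := ht.1
  positivity

end gp
end XM

namespace XM
section wire
variable {n m : ℕ}

theorem mvol_perm (K : Fin n → Set (Euc n)) (σ : Equiv.Perm (Fin n)) :
    mvol (fun l => K (σ l)) = mvol K := by
  unfold mvol
  refine Fintype.sum_equiv σ.finsetCongr _ _ fun S => ?_
  simp [Equiv.finsetCongr_apply]

theorem exists_perm (p q : Fin n → Prop) [DecidablePred p] [DecidablePred q]
    (h : (Finset.univ.filter p).card = (Finset.univ.filter q).card) :
    ∃ σ : Equiv.Perm (Fin n), ∀ l, q (σ l) ↔ p l := by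
  have h2 : Fintype.card {x // p x} = Fintype.card {x // q x} := by
    rw [Fintype.card_subtype, Fintype.card_subtype, h]
  obtain ⟨e⟩ := Fintype.card_eq.1 h2
  refine ⟨e.extendSubtype, fun l => ?_⟩
  by_cases hl : p l
  · exact iff_of_true (e.extendSubtype_mem l hl) hl
  · exact iff_of_false (e.extendSubtype_not_mem l hl) hl

theorem mvol_ite (p q : Fin n → Prop) [DecidablePred p] [DecidablePred q]
    (h : (Finset.univ.filter p).card = (Finset.univ.filter q).card) (B A : Set (Euc n)) :
    mvol (fun l => if p l then B else A) = mvol (fun l => if q l then B else A) := by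
  obtain ⟨σ, hσ⟩ := exists_perm p q h
  rw [← mvol_perm (fun l => if q l then B else A) σ]
  simp only [hσ]

theorem blocks_map {α γ : Type*} (i : Fin m → ℕ) (f : Fin m → α) (g : α → γ) :
    (blocks i f).map g = blocks i (fun k => g (f k)) := by
  unfold blocks
  rw [List.map_flatten, List.map_ofFn]
  congr 2
  ext1 k
  simp

theorem blocks_length {α : Type*} (i : Fin m → ℕ) (f : Fin m → α) :
    (blocks i f).length = ∑ k, i k := by
  unfold blocks
  rw [List.length_flatten, List.map_ofFn, List.sum_ofFn]
  simp

theorem blocks_count (i : Fin m → ℕ) (k : Fin m) :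
    (blocks i (some : Fin m → Option (Fin m))).count (some k) = i k := by
  unfold blocks
  rw [List.count_flatten, List.map_ofFn, List.sum_ofFn]
  simp [List.count_replicate]

theorem exists_beta (i : Fin m → ℕ) (hi : ∑ k, i k ≤ n) (A : Set (Euc n)) (B : Fin m → Set (Euc n)) :
    ∃ β : Fin n → Option (Fin m), (∀ l : Fin n,
      (blocks i B ++ List.replicate (n - ∑ k, i k) A).getD (l : ℕ) ∅ = (β l).elim A B) ∧
      ∀ k, (Finset.univ.filter fun l => β l = some k).card = i k := by
  set ℓ : List (Option (Fin m)) := blocks i some ++ List.replicate (n - ∑ k, i k) none with hℓ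
  have hlen : ℓ.length = n := by
    rw [hℓ, List.length_append, blocks_length, List.length_replicate]; omega
  refine ⟨List.Vector.get ⟨ℓ, hlen⟩, fun l => ?_, fun k => ?_⟩
  · have hmap : blocks i B ++ List.replicate (n - ∑ k, i k) A = ℓ.map (fun o => o.elim A B) := by
      rw [hℓ, List.map_append, blocks_map, List.map_replicate]
      rfl
    rw [hmap, List.getD_eq_getElem _ _ (by rw [List.length_map, hlen]; exact l.2), List.getElem_map]
    rfl
  · have := Fin.card_filter_univ_eq_vector_get_eq_count (some k) (⟨ℓ, hlen⟩ : List.Vector _ n)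
    rw [this]
    simp [List.Vector.toList, hℓ, List.count_replicate]
    convert blocks_count i k

theorem main (m n : ℕ) (hm : 1 ≤ m)
    (i : Fin m → ℕ) (hi : ∑ k, i k ≤ n)
    (A : Set (Euc n)) (B : Fin m → Set (Euc n))
    (hA : IsConvexBody A) (hB : ∀ k, IsConvexBody (B k)) (j : Fin m) :
    (((n.factorial * ((∑ k, i k) - i j).factorial : ℕ) : ℝ) /
        (((∏ k, (i k).factorial) * (n - i j).factorial : ℕ) : ℝ)) *
      (volume A).toReal ^ (m - 1) *
      mixedVolume (fun l : Fin n =>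
        (blocks i B ++ List.replicate (n - ∑ k, i k) A).getD (l : ℕ) ∅) ≤
    ∏ k, ((n.choose (i k) : ℝ) *
      mixedVolume (fun l : Fin n => if (l : ℕ) < i k then B k else A)) := by
  classical
  obtain ⟨β, hβ1, hβ2⟩ := exists_beta i hi A B
  simp only [hβ1, mixedVolume_eq]
  have hK : ∀ l, IsConvexBody ((β l).elim A B) := by
    intro l
    rcases β l with _ | k
    · exact hA
    · exact hB k
  have hG := G_body hm (fun l => (β l).elim A B) hK A hA (fun l => (β l).getD j)
  have hik : ∀ k, i k ≤ n := fun k =>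
    (Finset.single_le_sum (fun k _ => Nat.zero_le (i k)) (Finset.mem_univ k)).trans hi
  have hblock : ∀ k, mvol (fun l => if (β l).getD j = k then (β l).elim A B else A) =
      mvol (fun l : Fin n => if (l : ℕ) < i k then B k else A) := by
    intro k
    rw [← mvol_ite (fun l => β l = some k) (fun l : Fin n => (l : ℕ) < i k)]
    · congr 1
      ext1 l
      rcases h : β l with _ | k'
      · simp
      · by_cases hk : k' = k
        · subst hk; simp
        · simp [hk]
    · rw [hβ2]
      have := hik k
      simp [Fin.card_filter_val_lt, this]
  simp only [hblock] at hG
  set s : Fin m → ℕ := fun k => (Finset.univ.filter fun l => (β l).getD j = k).card with hs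
  have hsk : ∀ k, k ≠ j → s k = i k := by
    intro k hk
    rw [← hβ2 k]
    simp only [hs]
    congr 1
    ext l
    simp only [Finset.mem_filter, Finset.mem_univ, true_and]
    rcases β l with _ | k'
    · simp [hk.symm]
    · simp
  have hsum : ∑ k, s k = n := by
    have := Finset.card_eq_sum_card_fiberwise (s := (Finset.univ : Finset (Fin n)))
      (t := (Finset.univ : Finset (Fin m))) (f := fun l => (β l).getD j) (fun _ _ => Finset.mem_univ _)
    simpa [hs] using this.symm
  have hsj : n - s j = (∑ k, i k) - i j := by
    have h1 := Finset.add_sum_erase _ s (Finset.mem_univ j)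
    have h2 := Finset.add_sum_erase _ i (Finset.mem_univ j)
    have h3 : ∑ k ∈ Finset.univ.erase j, s k = ∑ k ∈ Finset.univ.erase j, i k :=
      Finset.sum_congr rfl fun k hk => hsk k (Finset.ne_of_mem_erase hk)
    rw [hsum, h3] at h1
    omega
  set v : Fin m → ℝ := fun k => mvol (fun l : Fin n => if (l : ℕ) < i k then B k else A) with hv
  set d := ∑ k, i k with hd
  have hG' : (volume A).toReal ^ (m - 1) * mvol (fun l => (β l).elim A B) ≤
      ∏ k, v k / ((n - s k).factorial : ℝ) := hG
  have e1 : ∏ k, ((n.choose (i k) : ℝ) * (((n.factorial : ℝ))⁻¹ * v k)) =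
      (∏ k, ((i k).factorial : ℝ))⁻¹ * ∏ k, v k / ((n - i k).factorial : ℝ) := by
    rw [← Finset.prod_inv_distrib, ← Finset.prod_mul_distrib]
    refine Finset.prod_congr rfl fun k _ => ?_
    rw [Nat.cast_choose ℝ (hik k)]
    have := Nat.factorial_ne_zero n
    field_simp
  have e2 : ∏ k, v k / ((n - i k).factorial : ℝ) =
      ((d - i j).factorial : ℝ) / ((n - i j).factorial : ℝ) * ∏ k, v k / ((n - s k).factorial : ℝ) := by
    rw [← Finset.mul_prod_erase _ _ (Finset.mem_univ j),
      ← Finset.mul_prod_erase _ (fun k => v k / ((n - s k).factorial : ℝ)) (Finset.mem_univ j),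
      ← mul_assoc, hsj]
    congr 1
    · have := Nat.factorial_ne_zero (d - i j)
      field_simp
    · refine Finset.prod_congr rfl fun k hk => ?_
      rw [hsk k (Finset.ne_of_mem_erase hk)]
  rw [e1, e2]
  push_cast
  have hn := Nat.factorial_ne_zero n
  calc _ = (∏ k, ((i k).factorial : ℝ))⁻¹ * (((d - i j).factorial : ℝ) / ((n - i j).factorial : ℝ) *
        ((volume A).toReal ^ (m - 1) * mvol (fun l => (β l).elim A B))) := by
        have h1 : (∏ k, ((i k).factorial : ℝ)) ≠ 0 :=
          Finset.prod_ne_zero_iff.2 fun k _ => by exact_mod_cast Nat.factorial_ne_zero (i k)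
        field_simp
    _ ≤ _ := by
        gcongr

end wire
end XM

theorem xiao_corollary_mixed_volume (m n : ℕ) (hm : 1 ≤ m) (hmn : m ≤ n)
    (i : Fin m → ℕ) (hi : ∑ k, i k ≤ n)
    (A : Set (EuclideanSpace ℝ (Fin n))) (B : Fin m → Set (EuclideanSpace ℝ (Fin n)))
    (hA : IsConvexBody A) (hB : ∀ k, IsConvexBody (B k)) (j : Fin m) :
    (((n.factorial * ((∑ k, i k) - i j).factorial : ℕ) : ℝ) /
        (((∏ k, (i k).factorial) * (n - i j).factorial : ℕ) : ℝ)) *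
      (volume A).toReal ^ (m - 1) *
      mixedVolume (fun l : Fin n =>
        (blocks i B ++ List.replicate (n - ∑ k, i k) A).getD (l : ℕ) ∅) ≤
    ∏ k, ((n.choose (i k) : ℝ) *
      mixedVolume (fun l : Fin n => if (l : ℕ) < i k then B k else A)) := by
  exact XM.main m n hm i hi A B hA hB j
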